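/- For every n ≥ 3 and every odd ℓ with ℓ ≤ n/2, there exists no coordinate-symmetric subspace extension of P_match(ℓ,n) with at most binomial(n, (ℓ−1)/2) variables; that is, there is no d ≤ binomial(n, (ℓ−1)/2), no set Q ⊆ ℝ^d that is the intersection of an affine subspace of ℝ^d with ℝ_+^d, and no affine map p : ℝ^d → ℝ^{E_n} with p(Q) = P_match(ℓ,n) such that for every π ∈ S_n (acting on ℝ^{E_n} by permuting the nodes of K_n) there is a coordinate permutation κ_π of ℝ^d with κ_π.Q = Q and p(κ_π.y) = π.p(y) for all y ∈ Q. -/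

import Mathlib

open scoped BigOperators
open Classical in
noncomputable section

/-- Edges of the complete graph `K_n` on the node set `Fin n`. -/
abbrev Edge (n : ℕ) := {e : Sym2 (Fin n) // ¬ e.IsDiag}

def edgeMap {n : ℕ} (π : Equiv.Perm (Fin n)) (e : Edge n) : Edge n :=
  ⟨Sym2.map π e.1, by rw [Sym2.isDiag_map (Equiv.injective π)]; exact e.2⟩

/-- Action of a node permutation on vectors indexed by edges:
`(π.x)_{{v,w}} = x_{{π⁻¹ v, π⁻¹ w}}`. -/
def edgeAction {n : ℕ} (π : Equiv.Perm (Fin n)) (x : Edge n → ℝ) : Edge n → ℝ :=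
  fun e => x (edgeMap π⁻¹ e)

/-- Action of a coordinate permutation `σ ∈ S_d` on `ℝ^d`: `(σ.y)_j = y_{σ⁻¹ j}`. -/
def coordAction {d : ℕ} (σ : Equiv.Perm (Fin d)) (y : Fin d → ℝ) : Fin d → ℝ :=
  fun j => y (σ⁻¹ j)

/-- A matching: a set of pairwise node-disjoint edges. -/
def IsMatching {n : ℕ} (M : Finset (Edge n)) : Prop :=
  ∀ e ∈ M, ∀ f ∈ M, e ≠ f → ∀ v : Fin n, ¬(v ∈ e.1 ∧ v ∈ f.1)

/-- Characteristic vector of a set of edges. -/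
def charVec {n : ℕ} (M : Finset (Edge n)) : Edge n → ℝ :=
  fun e => if e ∈ M then 1 else 0

/-- `P_match(ℓ,n)`: convex hull of characteristic vectors of size-`ℓ` matchings of `K_n`. -/
def matchingPolytope (n ℓ : ℕ) : Set (Edge n → ℝ) :=
  convexHull ℝ {x | ∃ M : Finset (Edge n), IsMatching M ∧ M.card = ℓ ∧ x = charVec M}

section Groups

open Nat in
lemma num_succ (n k : ℕ) : Nat.choose n (k+1) * (k+1) = Nat.choose n k * (n-k) := Nat.choose_succ_right_eq n k

lemma num_lt_succ {n k : ℕ} (h : 2*k+1 < n) : Nat.choose n k < Nat.choose n (k+1) := by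
  have h1 := num_succ n k
  have hp : 0 < Nat.choose n k := Nat.choose_pos (by omega)
  by_contra hc
  push Not at hc
  have h2 : Nat.choose n (k+1) * (k+1) ≤ Nat.choose n k * (k+1) := Nat.mul_le_mul_right _ hc
  have h3 : Nat.choose n k * (k+1) < Nat.choose n k * (n-k) := Nat.mul_lt_mul_of_pos_left (by omega) hp
  omega

lemma num_le_succ {n k : ℕ} (h : 2*k+1 ≤ n) : Nat.choose n k ≤ Nat.choose n (k+1) := by
  rcases h.eq_or_lt with h | h
  · subst h
    have := Nat.choose_symm_half k
    omega
  · exact (num_lt_succ h).le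

lemma num_mono {n k j : ℕ} (hkj : k ≤ j) (hj : 2 * j ≤ n + 1) : Nat.choose n k ≤ Nat.choose n j := by
  induction j, hkj using Nat.le_induction with
  | base => exact le_rfl
  | succ j hj' ih => exact (ih (by omega)).trans (num_le_succ (by omega))

lemma num_mid {n k j : ℕ} (hkj : k < j) (hj : j + k < n) : Nat.choose n k < Nat.choose n j := by
  rcases le_or_gt (2*j) n with h | h
  · exact lt_of_lt_of_le (num_lt_succ (by omega)) (num_mono (show k+1 ≤ j by omega) (by omega))
  · rw [← Nat.choose_symm (show j ≤ n by omega)]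
    exact lt_of_lt_of_le (num_lt_succ (by omega)) (num_mono (show k+1 ≤ n - j by omega) (by omega))

lemma num_seven {n k : ℕ} (hk : 1 ≤ k) (hn : 4*k+2 ≤ n) : 7 * Nat.choose n k ≤ 2^n := by
  have h1 := num_succ n k
  have h2 : 5 * Nat.choose n k ≤ 2 * Nat.choose n (k+1) := by
    have : 5 * (k+1) ≤ 2 * (n-k) := by omega
    have h3 : (5 * Nat.choose n k) * (k+1) ≤ (2 * Nat.choose n (k+1)) * (k+1) := by
      calc (5 * Nat.choose n k) * (k+1) = Nat.choose n k * (5 * (k+1)) := by ring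
        _ ≤ Nat.choose n k * (2 * (n-k)) := Nat.mul_le_mul_left _ this
        _ = 2 * (Nat.choose n k * (n-k)) := by ring
        _ = _ := by rw [← h1]; ring
    exact Nat.le_of_mul_le_mul_right h3 (by omega)
  rw [← Nat.sum_range_choose]
  have hs : ({k, k+1, n-k, n-(k+1)} : Finset ℕ) ⊆ Finset.range (n+1) := by
    intro x; simp; omega
  refine le_trans ?_ (Finset.sum_le_sum_of_subset hs)
  rw [Finset.sum_insert (by simp; omega), Finset.sum_insert (by simp; omega), Finset.sum_insert (by simp; omega), Finset.sum_singleton, Nat.choose_symm (by omega), Nat.choose_symm (by omega)]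
  omega

lemma num_four {h : ℕ} (hh : 6 ≤ h) : 4^h < 7 * Nat.factorial h := by
  induction h, hh using Nat.le_induction with
  | base => decide
  | succ h hh ih =>
    rw [pow_succ, Nat.factorial_succ]
    nlinarith [Nat.factorial_pos h]

lemma num_bochert {n k : ℕ} (hk : 1 ≤ k) (hn : 4*k+2 ≤ n) (hn2 : 8 + k ≤ n) :
    Nat.choose n k < Nat.factorial ((n+1)/2) := by
  rcases le_or_gt n 10 with h | h
  · have : k ≤ 2 := by omega
    interval_cases n <;> interval_cases k <;> first | omega | decide
  · have h1 := num_seven hk hn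
    have h2 := num_four (show 6 ≤ (n+1)/2 by omega)
    have h3 : 2^n ≤ 4^((n+1)/2) := by
      rw [show (4:ℕ) = 2^2 by norm_num, ← pow_mul]
      exact Nat.pow_le_pow_right (by norm_num) (by omega)
    omega

lemma num_pow_choose (i r : ℕ) : i^r ≤ Nat.choose (i * (r+1) - 1) r := by
  rcases Nat.eq_zero_or_pos i with rfl | hi
  · rcases r with _ | r <;> simp
  induction r with
  | zero => simp
  | succ r ih =>
    have e : i * (r+1+1) - 1 = (i*(r+1) - 1 + (i-1)) + 1 := by
      have : 0 < i * (r+1) := by positivity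
      have : i * (r+1+1) = i*(r+1) + i := by ring
      omega
    have h1 := Nat.add_one_mul_choose_eq (i*(r+1) - 1 + (i-1)) r
    rw [← e] at h1
    have h2 : Nat.choose (i*(r+1) - 1) r ≤ Nat.choose (i*(r+1) - 1 + (i-1)) r := Nat.choose_le_choose _ (by omega)
    have h4 : i * (r+1) ≤ i*(r+1+1) - 1 := by omega
    have h3 : i^(r+1) * (r+1) ≤ Nat.choose (i * (r+1+1) - 1) (r+1) * (r+1) := by
      rw [← h1]
      calc i^(r+1)*(r+1) = i*(r+1) * i^r := by ring
        _ ≤ _ := Nat.mul_le_mul (by omega) (ih.trans h2)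
    exact Nat.le_of_mul_le_mul_right h3 (by omega)

lemma num_base3 (b : ℕ) : 8^(b+2) < 7 * (Nat.choose (2*b+3) (b+1) * Nat.choose (3*b+5) (b+1)) := by
  induction b with
  | zero => decide
  | succ b ih =>
    have h1 : 3 * Nat.choose (2*b+3) (b+1) ≤ Nat.choose (2*(b+1)+3) (b+1+1) := by
      have e1 := Nat.add_one_mul_choose_eq (2*b+4) (b+1)
      have e2 := Nat.choose_mul_succ_eq (2*b+3) (b+1)
      rw [show 2*b+3+1-(b+1) = b+3 by omega] at e2
      have e3 : Nat.choose (2*(b+1)+3) (b+1+1) * ((b+2) * (b+3)) = (2*b+5)*(2*b+4) * Nat.choose (2*b+3) (b+1) := by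
        calc _ = (Nat.choose (2*b+4+1) (b+1+1) * (b+1+1)) * (b+3) := by ring_nf
          _ = (2*b+5) * (Nat.choose (2*b+3+1) (b+1) * (b+3)) := by rw [← e1]; ring
          _ = _ := by rw [← e2]; ring
      have : 3 * Nat.choose (2*b+3) (b+1) * ((b+2) * (b+3)) ≤ Nat.choose (2*(b+1)+3) (b+1+1) * ((b+2) * (b+3)) := by
        rw [e3]
        calc _ = (3 * ((b+2)*(b+3))) * Nat.choose (2*b+3) (b+1) := by ring
          _ ≤ _ := Nat.mul_le_mul_right _ (by nlinarith)
      exact Nat.le_of_mul_le_mul_right this (by positivity)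
    have h2 : 3 * Nat.choose (3*b+5) (b+1) ≤ Nat.choose (3*(b+1)+5) (b+1+1) := by
      have e1 := Nat.add_one_mul_choose_eq (3*b+7) (b+1)
      have e2 : Nat.choose (3*b+5) (b+1) ≤ Nat.choose (3*b+7) (b+1) := Nat.choose_le_choose _ (by omega)
      have : 3 * Nat.choose (3*b+5) (b+1) * (b+2) ≤ Nat.choose (3*(b+1)+5) (b+1+1) * (b+2) := by
        rw [show 3*(b+1)+5 = 3*b+7+1 by ring, show b + 2 = b+1+1 by ring, ← e1]
        nlinarith
      exact Nat.le_of_mul_le_mul_right this (by positivity)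
    have h3 := Nat.mul_le_mul h1 h2
    rw [pow_succ]
    have := Nat.choose_pos (show b+1 ≤ 2*b+3 by omega)
    nlinarith

lemma num_bell3 {b c : ℕ} (hb : 2 ≤ b) (hc : 3 ≤ c) : 2^(c*b) < 7 * Nat.uniformBell c b := by
  induction c, hc using Nat.le_induction with
  | base =>
    obtain ⟨b, rfl⟩ := Nat.exists_eq_add_of_le' hb
    have := num_base3 b
    rw [Nat.uniformBell_succ_left, Nat.uniformBell_succ_left, Nat.uniformBell_one_left, pow_mul, mul_one]
    rw [show 2 * (b+2) + (b+2) - 1 = 3*b+5 by omega, show 1 * (b+2) + (b+2) - 1 = 2*b+3 by omega, mul_comm (Nat.choose _ _)]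
    exact this
  | succ c hc ih =>
    obtain ⟨b, rfl⟩ := Nat.exists_eq_add_of_le' hb
    rw [Nat.uniformBell_succ_left]
    have h := num_pow_choose (c+1) (b+1)
    rw [show (c+1)*(b+1+1) - 1 = c * (b+2) + (b+2) - 1 by rw [Nat.add_mul]; simp] at h
    have h2 : 2^(b+2) ≤ (c+1)^(b+1) := by
      calc 2^(b+2) ≤ 2^(2*(b+1)) := Nat.pow_le_pow_right (by norm_num) (by omega)
        _ = 4^(b+1) := by rw [pow_mul]; norm_num
        _ ≤ _ := Nat.pow_le_pow_left (by omega) _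
    have h3 := Nat.mul_lt_mul_of_lt_of_le ih (h2.trans h) (lt_of_lt_of_le (by positivity) h2 |>.trans_le h)
    rw [Nat.add_mul, pow_add, one_mul]
    calc _ < _ := h3
      _ = _ := by rw [show b + 2 - 1 = b+1 by omega]; ring

lemma num_bell {b c k : ℕ} (hb : 2 ≤ b) (hc : 2 ≤ c) (hk : 1 ≤ k) (hn : 4*k+2 ≤ c*b) :
    Nat.choose (c*b) k < Nat.uniformBell c b := by
  rcases hc.eq_or_lt with rfl | hc
  · rw [Nat.uniformBell_succ_left, Nat.uniformBell_one_left, mul_one]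
    obtain ⟨m, hm⟩ : ∃ m, 2 * b = m + 1 := ⟨2*b-1, by omega⟩
    rw [show 1 * b + b - 1 = m by omega, hm]
    obtain ⟨k, rfl⟩ := Nat.exists_eq_add_of_le' hk
    rw [Nat.choose_succ_succ']
    have h1 : Nat.choose m k < Nat.choose m (k+1) := num_lt_succ (by omega)
    have h2 := num_succ m (k+1)
    have h3 : 2 * Nat.choose m (k+1) ≤ Nat.choose m (k+1+1) := by
      have : Nat.choose m (k+1) * (2 * (k+2)) ≤ Nat.choose m (k+1) * (m - (k+1)) := Nat.mul_le_mul_left _ (by omega)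
      have : (2 * Nat.choose m (k+1)) * (k+2) ≤ Nat.choose m (k+1+1) * (k+2) := by
        rw [show Nat.choose m (k+1+1) * (k+2) = Nat.choose m (k+1+1) * (k+1+1) by ring, h2]; linarith
      exact Nat.le_of_mul_le_mul_right this (by omega)
    have h4 : Nat.choose m (k+1+1) ≤ Nat.choose m (b-1) := num_mono (by omega) (by omega)
    omega
  · have := num_seven hk hn
    have := num_bell3 hb hc
    omega
open Equiv MulAction
open scoped Pointwise

lemma grp_index_ge {α : Type} [Fintype α] [DecidableEq α] (G : Subgroup (Perm α)) {a b : ℕ}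
    (h : Nat.card G ≤ b) (hab : a * b = (Fintype.card α).factorial) : a ≤ G.index := by
  have h1 := G.index_mul_card
  rw [Nat.card_perm, Nat.card_eq_fintype_card (α := α), ← hab] at h1
  have hb : 0 < b := lt_of_lt_of_le Nat.card_pos h
  have h2 : a * b ≤ G.index * b := by rw [← h1]; exact Nat.mul_le_mul_left _ h
  exact Nat.le_of_mul_le_mul_right h2 hb

lemma grp_inv {α : Type} [Fintype α] [DecidableEq α] (G : Subgroup (Perm α)) (O : Finset α)
    (hO : ∀ g ∈ G, ∀ a, g a ∈ O ↔ a ∈ O) : Nat.choose (Fintype.card α) O.card ≤ G.index := by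
  classical
  have hc := Nat.choose_mul_factorial_mul_factorial (Finset.card_le_univ O)
  rw [mul_assoc] at hc
  refine grp_index_ge G ?_ hc
  let f : α → Bool := fun a => decide (a ∈ O)
  have h1 := DomMulAct.stabilizer_card f
  rw [Fintype.prod_bool] at h1
  have e1 : Fintype.card {a // f a = true} = O.card := by
    rw [Fintype.card_subtype]; congr 1; ext a; simp [f]
  have e2 : Fintype.card {a // f a = false} = Fintype.card α - O.card := by
    rw [Fintype.card_subtype, ← Finset.card_compl]; congr 1; ext a; simp [f]
  rw [e1, e2] at h1
  rw [← h1, ← Nat.card_eq_fintype_card]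
  refine Nat.card_le_card_of_injective (fun g : G => (⟨g.1, ?_⟩ : {g : Perm α // f ∘ g = f})) ?_
  · ext a; simp [f, hO g.1 g.2 a]
  · intro g g' h; ext1; simpa using h

lemma grp_threeCycle {α : Type} [Fintype α] [DecidableEq α] (x y : Perm α) (a : α)
    (hx : x a ≠ a) (hy : y a ≠ a) (hxy : ∀ b, x b ≠ b → y b ≠ b → b = a) :
    (x * y * x⁻¹ * y⁻¹).IsThreeCycle := by
  rw [← card_support_eq_three_iff]
  have key : (x * y * x⁻¹ * y⁻¹).support = {a, x a, y a} := by
    have hyx : y (x a) = x a := by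
      by_contra h
      have := hxy (x a) (fun h' => hx (x.injective h')) h
      exact hx this
    have hxy' : x (y a) = y a := by
      by_contra h
      have := hxy (y a) h (fun h' => hy (y.injective h'))
      exact hy this
    ext b
    obtain ⟨b, rfl⟩ := y.surjective b
    obtain ⟨b, rfl⟩ := x.surjective b
    have hc : (x * y * x⁻¹ * y⁻¹) (y (x b)) = x (y b) := by simp [Perm.mul_apply]
    rw [Perm.mem_support, hc]
    simp only [Finset.mem_insert, Finset.mem_singleton]
    constructor
    · intro h
      by_cases hxb : x b = b
      · rw [hxb] at h ⊢
        have hyb : y b ≠ b := fun h' => h (by rw [h', hxb])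
        left
        exact hxy _ h (fun h' => hyb (y.injective h'))
      · by_cases hyb : y b = b
        · rw [hyb] at h
          have := hxy (x b) (fun h' => hxb (x.injective h')) (Ne.symm h)
          right; right; rw [this]
        · have := hxy b hxb hyb
          subst this
          right; left; exact hyx
    · rintro (h | h | h)
      · have hyb : y b ≠ b := by
          intro hyb
          by_cases hxb : x b = b
          · rw [hxb, hyb] at h; exact hy (h ▸ hyb)
          · have h1 : y (x b) = x b := by
              by_contra h2
              have h3 := hxy (x b) (fun h' => hxb (x.injective h')) h2
              rw [h3] at h; exact hy h
            rw [h1] at h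
            rw [← h, h1] at hy
            exact hy rfl
        have hxb : x b = b := by
          by_contra hxb
          have := hxy b hxb hyb
          subst this
          rw [hyx] at h; exact hxb h
        rw [h]
        rw [hxb] at h
        rw [h]; exact hx
      · have : b = a := x.injective (y.injective (h.trans hyx.symm))
        subst this
        rw [hxy', hyx]
        intro h
        have := hxy (x b) (fun h' => hx (x.injective h')) (by rw [← h]; exact fun h' => hy (y.injective h'))
        exact hx this
      · have h1 : x b = a := y.injective h
        have hyb : y b = b := by
          by_contra hyb
          have hxb : x b ≠ b := by
            intro h2; rw [h2] at h1; subst h1; exact hx h2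
          have := hxy b hxb hyb
          subst this
          exact hx h1
        rw [hyb, h1]; exact hy.symm
  rw [key]
  have : x a ≠ y a := by
    intro h
    have := hxy (x a) (fun h' => hx (x.injective h')) (by rw [h]; exact fun h' => hy (y.injective h'))
    exact hx this
  rw [Finset.card_insert_of_notMem, Finset.card_pair this]
  simp [hx.symm, hy.symm]

lemma grp_bochert {α : Type} [Fintype α] [DecidableEq α] (G : Subgroup (Perm α))
    (h3 : ∀ g ∈ G, ¬ g.IsThreeCycle) : Nat.factorial ((Fintype.card α + 1)/2) ≤ G.index := by
  classical
  let P : ℕ → Prop := fun m => ∃ S : Finset α, S.card = m ∧ ∀ g ∈ G, (∀ v ∈ S, g v = v) → g = 1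
  have hP : ∃ m, P m := ⟨_, Finset.univ, rfl, fun g _ h => by ext v; exact h v (Finset.mem_univ v)⟩
  obtain ⟨S, hS, hS1⟩ := Nat.find_spec hP
  have hmin : ∀ T : Finset α, (∀ g ∈ G, (∀ v ∈ T, g v = v) → g = 1) → S.card ≤ T.card := by
    intro T hT
    rw [hS]
    exact Nat.find_min' hP ⟨T, rfl, hT⟩
  have hcompl : ∀ g ∈ G, (∀ v ∈ Sᶜ, g v = v) → g = 1 := by
    intro y hy hyS
    by_contra hne
    obtain ⟨a, ha⟩ : ∃ a, y a ≠ a := by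
      by_contra hcon
      push Not at hcon
      exact hne (by ext v; simp [hcon v])
    have haS : a ∈ S := by
      by_contra h
      exact ha (hyS a (by simpa using h))
    have : ¬ ∀ g ∈ G, (∀ v ∈ S.erase a, g v = v) → g = 1 := by
      intro hcon
      have := hmin _ hcon
      rw [Finset.card_erase_of_mem haS] at this
      have := Finset.card_pos.2 ⟨a, haS⟩
      omega
    push Not at this
    obtain ⟨x, hx, hxS, hx1⟩ := this
    have hxa : x a ≠ a := by
      intro h
      apply hx1
      apply hS1 x hx
      intro v hv
      by_cases hva : v = a
      · rw [hva, h]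
      · exact hxS v (Finset.mem_erase.2 ⟨hva, hv⟩)
    refine h3 _ (G.mul_mem (G.mul_mem (G.mul_mem hx hy) (G.inv_mem hx)) (G.inv_mem hy)) (grp_threeCycle x y a hxa ha ?_)
    intro b hxb hyb
    by_contra hba
    by_cases hbS : b ∈ S
    · exact hxb (hxS b (Finset.mem_erase.2 ⟨hba, hbS⟩))
    · exact hyb (hyS b (by simpa using hbS))
  have h1 := hmin _ hcompl
  rw [Finset.card_compl] at h1
  have h2 : Nat.card G * Nat.factorial (Fintype.card α - S.card) ≤ Nat.factorial (Fintype.card α) := by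
    have e : Nat.factorial (Fintype.card α - S.card) = Nat.card (Perm {v // v ∉ S}) := by
      rw [Nat.card_perm, Nat.card_eq_fintype_card, Fintype.card_subtype_compl, Fintype.card_coe]
    rw [e, ← Nat.card_prod, ← Nat.card_eq_fintype_card (α := α), ← Nat.card_perm]
    refine Nat.card_le_card_of_injective (fun q : G × Perm {v // v ∉ S} => q.1.1 * Perm.ofSubtype q.2) ?_
    rintro ⟨g, h⟩ ⟨g', h'⟩ heq
    simp only at heq
    have hfix : ∀ h : Perm {v // v ∉ S}, ∀ v ∈ S, Perm.ofSubtype h v = v := fun h v hv =>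
      Perm.ofSubtype_apply_of_not_mem h (by simpa using hv)
    have h0 : g.1 = g'.1 := by
      have : g'.1⁻¹ * g.1 = 1 := by
        apply hS1 _ (G.mul_mem (G.inv_mem g'.2) g.2)
        intro v hv
        have := congrArg (fun p : Perm α => p v) heq
        simp only [Perm.mul_apply, hfix _ v hv] at this
        rw [Perm.mul_apply, this]; simp
      rw [inv_mul_eq_one] at this
      exact this.symm
    rw [h0] at heq
    have := Perm.ofSubtype_injective (mul_left_cancel heq)
    rw [this, Subtype.ext h0]
  have h4 := G.index_mul_card
  rw [Nat.card_perm, Nat.card_eq_fintype_card (α := α)] at h4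
  rw [← h4, mul_comm] at h2
  have h5 := Nat.le_of_mul_le_mul_right h2 Nat.card_pos
  refine le_trans (Nat.factorial_le ?_) h5
  omega

lemma grp_block {α : Type} [Fintype α] [DecidableEq α] (G : Subgroup (Perm α)) [IsPretransitive G α]
    (B : Set α) (hB : IsBlock G B) (hne : B.Nonempty) :
    ∃ c b, b = B.ncard ∧ c * b = Fintype.card α ∧ Nat.uniformBell c b ≤ G.index := by
  classical
  have h0 := hB.ncard_block_mul_ncard_orbit_eq hne
  let O := orbit G B
  have hex : ∀ a : α, ∃ g : G, a ∈ g • B := by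
    intro a
    obtain ⟨b, hb⟩ := hne
    obtain ⟨g, hg⟩ := exists_smul_eq G b a
    exact ⟨g, hg ▸ Set.smul_mem_smul_set hb⟩
  choose t ht using hex
  let f : α → O := fun a => ⟨t a • B, mem_orbit _ _⟩
  have hf : ∀ (a : α) (s : O), f a = s ↔ a ∈ s.1 := by
    intro a s
    constructor
    · rintro rfl; exact ht a
    · intro h
      obtain ⟨_, g, rfl⟩ := s
      apply Subtype.ext
      exact (isBlock_iff_smul_eq_smul_of_nonempty.1 hB) ⟨a, ht a, h⟩
  have hcard : ∀ s : O, Fintype.card {a // f a = s} = B.ncard := by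
    intro s
    obtain ⟨_, g, rfl⟩ := s
    rw [← Set.ncard_smul_set g B, ← Nat.card_eq_fintype_card, ← Nat.card_coe_set_eq]
    exact Nat.card_congr (Equiv.subtypeEquivRight fun a => hf a _)
  have : Fintype O := Fintype.ofFinite _
  have hk : Nat.card (toPermHom G O).ker ≤ (B.ncard).factorial ^ (Fintype.card O) := by
    have h1 := DomMulAct.stabilizer_card f
    simp only [hcard, Finset.prod_const, Finset.card_univ] at h1
    rw [← h1, ← Nat.card_eq_fintype_card]
    refine Nat.card_le_card_of_injective (fun g : (toPermHom G O).ker => (⟨g.1.1, ?_⟩ : {g : Perm α // f ∘ g = f})) ?_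
    · ext1 a
      simp only [Function.comp]
      rw [hf]
      have h2 : g.1 • (f a) = f a := by
        have := congrArg (fun p : Perm O => p (f a)) (MonoidHom.mem_ker.1 g.2)
        simpa using this
      have h3 : g.1 • (f a).1 = (f a).1 := congrArg Subtype.val h2
      rw [← h3]
      exact Set.smul_mem_smul_set ((hf a _).1 rfl)
    · intro g g' h; ext1; ext1; simpa using h
  have hr : Nat.card (toPermHom G O).range ≤ (Fintype.card O).factorial := by
    rw [← Nat.card_eq_fintype_card, ← Nat.card_perm]
    exact Subgroup.card_le_card_group _
  have hG : Nat.card G ≤ (B.ncard).factorial ^ (Fintype.card O) * (Fintype.card O).factorial := by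
    rw [← (toPermHom G O).ker.card_mul_index, Subgroup.index_ker]
    exact Nat.mul_le_mul hk hr
  have hO : Fintype.card O = (orbit G B).ncard := by
    rw [← Nat.card_eq_fintype_card, Nat.card_coe_set_eq]
  rw [Nat.card_eq_fintype_card] at h0
  refine ⟨Fintype.card O, B.ncard, rfl, by rw [hO, mul_comm]; exact h0, ?_⟩
  refine grp_index_ge G hG ?_
  rw [← mul_assoc, Nat.uniformBell_mul_eq, hO, mul_comm, h0]
  exact ((Set.ncard_pos (Set.toFinite B)).2 hne).ne'

lemma grp_transitive {α : Type} [Fintype α] [DecidableEq α] (G : Subgroup (Perm α)) [IsPretransitive G α]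
    {k : ℕ} (hk : 1 ≤ k) (h1 : 4 * k + 2 ≤ Fintype.card α) (h2 : 8 + k ≤ Fintype.card α)
    (hi : G.index ≤ Nat.choose (Fintype.card α) k) : alternatingGroup α ≤ G := by
  classical
  have h3 : ∃ g ∈ G, g.IsThreeCycle := by
    by_contra hcon
    push Not at hcon
    have := grp_bochert G hcon
    have := num_bochert hk h1 h2
    omega
  obtain ⟨g, hg, hg3⟩ := h3
  refine Equiv.Perm.alternatingGroup_le_of_isPreprimitive_of_isThreeCycle_mem ⟨?_⟩ hg3 hg
  intro B hB
  by_contra hnt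
  rw [IsTrivialBlock, not_or, Set.not_subsingleton_iff] at hnt
  obtain ⟨hB1, hB2⟩ := hnt
  obtain ⟨c, b, hb, hcb, hbell⟩ := grp_block G B hB hB1.nonempty
  have hb2 : 2 ≤ b := by
    rw [hb]
    exact (Set.one_lt_ncard (Set.toFinite B)).2 hB1
  have hc2 : 2 ≤ c := by
    by_contra hc
    have : b < Fintype.card α := by
      rw [hb, ← Nat.card_eq_fintype_card]
      exact Set.ncard_lt_card hB2
    interval_cases c <;> omega
  have := num_bell hb2 hc2 hk (by omega)
  rw [hcb] at this
  omega

lemma grp_main : ∀ (k : ℕ) (α : Type) [Fintype α] [DecidableEq α] (G : Subgroup (Perm α)),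
    4 * k + 2 ≤ Fintype.card α → 8 + k ≤ Fintype.card α →
    G.index ≤ Nat.choose (Fintype.card α) k →
    ∃ W : Finset α, W.card ≤ k ∧ ∀ π : Perm α, Perm.sign π = 1 → (∀ v ∈ W, π v = v) → π ∈ G := by
  intro k
  induction k with
  | zero =>
    intro α _ _ G _ _ hi
    refine ⟨∅, le_rfl, fun π _ _ => ?_⟩
    have h1 : G.index = 1 := by
      have := G.index_ne_zero_of_finite
      rw [Nat.choose_zero_right] at hi
      omega
    rw [Subgroup.index_eq_one.1 h1]
    trivial
  | succ k ih =>
    intro α _ _ G h1 h2 hi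
    classical
    let O : α → Finset α := fun x => Finset.univ.filter (fun y => y ∈ orbit G x)
    have hOmem : ∀ x y, y ∈ O x ↔ y ∈ orbit G x := by intro x y; simp [O]
    have hOcard : ∀ x, (O x).card = Nat.card (orbit G x) := by
      intro x
      rw [Nat.card_eq_fintype_card, Fintype.card_ofFinset]
    by_cases hsmall : ∃ x, (O x).card ≤ k + 1
    · obtain ⟨x, hx⟩ := hsmall
      let β := {y : α // y ≠ x}
      let G' : Subgroup (Perm β) := G.comap Perm.ofSubtype
      have hβ : Fintype.card β = Fintype.card α - 1 := by
        simp [β, Fintype.card_subtype_compl]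
      have hcard : Nat.card G' = Nat.card (stabilizer G x) := by
        refine Nat.card_congr (Equiv.ofBijective (fun g : G' => (⟨⟨Perm.ofSubtype g.1, g.2⟩, ?_⟩ : stabilizer G x)) ⟨?_, ?_⟩)
        · rw [mem_stabilizer_iff]
          exact Perm.ofSubtype_apply_of_not_mem _ (by simp)
        · intro g g' h
          have h' : Perm.ofSubtype g.1 = Perm.ofSubtype g'.1 := congrArg (fun q : stabilizer G x => q.1.1) h
          exact Subtype.ext (Perm.ofSubtype_injective h')
        · rintro ⟨⟨g, hg⟩, hgx⟩
          have hgx' : g x = x := hgx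
          have hh : ∀ y, g y ≠ x ↔ y ≠ x := by
            intro y
            rw [not_iff_not]
            constructor
            · intro h; exact g.injective (h.trans hgx'.symm)
            · rintro rfl; exact hgx'
          have he : Perm.ofSubtype (g.subtypePerm hh) = g :=
            Perm.ofSubtype_subtypePerm (p := fun y => y ≠ x) hh (fun y hy => by rintro rfl; exact hy hgx')
          refine ⟨⟨g.subtypePerm hh, ?_⟩, ?_⟩
          · show Perm.ofSubtype _ ∈ G
            rw [he]; exact hg
          · apply Subtype.ext; apply Subtype.ext; exact he
      have hidx : G'.index ≤ Nat.choose (Fintype.card β) k := by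
        have e1 := G'.index_mul_card
        have e2 := G.index_mul_card
        have e3 : Nat.card (orbit G x) * Nat.card (stabilizer G x) = Nat.card G := by
          rw [← Nat.card_prod]; exact Nat.card_congr (orbitProdStabilizerEquivGroup G x)
        rw [Nat.card_perm, Nat.card_eq_fintype_card (α := β), hβ] at e1
        rw [Nat.card_perm, Nat.card_eq_fintype_card (α := α)] at e2
        obtain ⟨m, hm⟩ : ∃ m, Fintype.card α = m + 1 := ⟨Fintype.card α - 1, by omega⟩
        rw [hβ]
        rw [hm] at e1 e2 hi ⊢
        simp only [Nat.add_sub_cancel] at e1 ⊢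
        rw [Nat.factorial_succ, ← e1, hcard] at e2
        rw [← e3, ← hOcard] at e2
        have hpos : 0 < Nat.card (stabilizer G x) := Nat.card_pos
        have e4 : G.index * (O x).card = (m+1) * G'.index :=
          Nat.eq_of_mul_eq_mul_right hpos (by rw [mul_assoc, e2, mul_assoc])
        have e5 := Nat.add_one_mul_choose_eq m k
        have e6 : (m+1) * G'.index ≤ (m+1) * Nat.choose m k := by
          rw [e5, ← e4]
          exact Nat.mul_le_mul hi hx
        exact Nat.le_of_mul_le_mul_left e6 (by omega)
      obtain ⟨W, hW, hWG⟩ := ih β G' (by omega) (by omega) hidx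
      refine ⟨insert x (W.map (Function.Embedding.subtype _)), ?_, ?_⟩
      · refine (Finset.card_insert_le _ _).trans ?_
        rw [Finset.card_map]; omega
      · intro g hs hg
        have hgx' : g x = x := hg x (Finset.mem_insert_self _ _)
        have hh : ∀ y, g y ≠ x ↔ y ≠ x := by
          intro y
          rw [not_iff_not]
          constructor
          · intro h; exact g.injective (h.trans hgx'.symm)
          · rintro rfl; exact hgx'
        have he : Perm.ofSubtype (g.subtypePerm hh) = g :=
          Perm.ofSubtype_subtypePerm (p := fun y => y ≠ x) hh (fun y hy => by rintro rfl; exact hy hgx')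
        rw [← he]
        refine hWG _ ?_ ?_
        · rw [← he, Perm.sign_ofSubtype] at hs; exact hs
        · intro v hv
          apply Subtype.ext
          exact hg v.1 (Finset.mem_insert_of_mem (Finset.mem_map.2 ⟨v, hv, rfl⟩))
    · push Not at hsmall
      have hbig : ∀ x, Fintype.card α ≤ (O x).card + (k+1) := by
        intro x
        by_contra hcon
        have h3 := grp_inv G (O x) (by
          intro g hg a
          rw [hOmem, hOmem]
          rw [← orbit_eq_iff, ← orbit_eq_iff, ← orbit_smul (⟨g, hg⟩ : G) a]; rfl)
        have h4 := num_mid (hsmall x) (show (O x).card + (k+1) < Fintype.card α by omega)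
        omega
      have : IsPretransitive G α := by
        refine ⟨fun x y => ?_⟩
        by_contra hcon
        have hd : Disjoint (O x) (O y) := by
          rw [Finset.disjoint_left]
          intro z hz hz'
          rw [hOmem] at hz hz'
          apply hcon
          have : y ∈ orbit G x := by
            rw [← orbit_eq_iff] at hz hz' ⊢
            rw [← hz, ← hz']
          exact this
        have h3 := Finset.card_le_univ (O x ∪ O y)
        rw [Finset.card_union_of_disjoint hd] at h3
        have := hbig x
        have := hbig y
        omega
      have hA := grp_transitive G (by omega) h1 h2 hi
      exact ⟨∅, by simp, fun π hπ _ => hA (Perm.mem_alternatingGroup.2 hπ)⟩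

end Groups

section Comb

open Equiv

def pcol (n l : ℕ) (v : Fin n) : Fin 3 := if v.1 < l then 0 else if v.1 < 2 * l then 1 else 2

/-- fixed-point-free involutions on the first `2l` nodes -/
def IsPM (n l : ℕ) (m : Perm (Fin n)) : Prop :=
  (∀ v, m (m v) = v) ∧ (∀ v, m v = v ↔ pcol n l v = 2)

def pcr (n l : ℕ) (m : Perm (Fin n)) : ℕ :=
  (Finset.univ.filter (fun v : Fin n => pcol n l v = 0 ∧ pcol n l (m v) = 1)).card

open Classical in
noncomputable def PMi (n l i : ℕ) : Finset (Perm (Fin n)) :=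
  Finset.univ.filter (fun m => IsPM n l m ∧ pcr n l m = i)

lemma mem_PMi {n l i : ℕ} {m : Perm (Fin n)} : m ∈ PMi n l i ↔ IsPM n l m ∧ pcr n l m = i := by
  simp [PMi]

lemma isPM_col {n l : ℕ} {m : Perm (Fin n)} (h : IsPM n l m) (v : Fin n) :
    pcol n l (m v) = 2 ↔ pcol n l v = 2 := by
  rw [← h.2, ← h.2, h.1]
  exact eq_comm

lemma conj_PMi {n l i : ℕ} {m : Perm (Fin n)} (g : Perm (Fin n)) (hg : ∀ u, pcol n l (g u) = pcol n l u)
    (hm : m ∈ PMi n l i) : g * m * g⁻¹ ∈ PMi n l i := by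
  rw [mem_PMi] at hm ⊢
  obtain ⟨⟨h1, h2⟩, h3⟩ := hm
  have hg' : ∀ u, pcol n l (g⁻¹ u) = pcol n l u := by
    intro u; rw [← hg]; simp
  refine ⟨⟨?_, ?_⟩, ?_⟩
  · intro v; simp [Perm.mul_apply, h1]
  · intro v
    rw [← hg' v, ← h2]
    simp only [Perm.mul_apply]
    rw [← Perm.eq_inv_iff_eq]
  · rw [← h3]
    refine (Finset.card_bij (fun v _ => g v) ?_ ?_ ?_).symm
    · intro v hv
      simp only [Finset.mem_filter, Finset.mem_univ, true_and] at hv ⊢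
      refine ⟨by rw [hg]; exact hv.1, ?_⟩
      simp [Perm.mul_apply, hg, hv.2]
    · intro a _ b _ h; exact g.injective h
    · intro v hv
      simp only [Finset.mem_filter, Finset.mem_univ, true_and, Perm.mul_apply, hg] at hv ⊢
      exact ⟨g⁻¹ v, ⟨by rw [hg']; exact hv.1, hv.2⟩, by simp⟩

open Classical in
noncomputable def evs (n l i : ℕ) (m0 : Perm (Fin n)) (S : Finset (Fin n)) : Finset (Perm (Fin n)) :=
  (PMi n l i).filter (fun m => ∀ v ∈ S, m v = m0 v)

lemma conj_evs_le {n l i : ℕ} {m0 : Perm (Fin n)} {S : Finset (Fin n)} (g : Perm (Fin n))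
    (hg : ∀ u, pcol n l (g u) = pcol n l u) (hgS : ∀ u ∈ S, g u = u ∧ g (m0 u) = m0 u) (x y : Fin n) :
    ((evs n l i m0 S).filter (fun m => m x = y)).card ≤
      ((evs n l i m0 S).filter (fun m => m (g x) = g y)).card := by
  classical
  refine Finset.card_le_card_of_injOn (fun m => g * m * g⁻¹) ?_ ?_
  · intro m hm
    simp only [evs, Finset.coe_filter, Finset.mem_filter, Set.mem_ofPred_eq] at hm ⊢
    refine ⟨⟨conj_PMi g hg hm.1.1, ?_⟩, ?_⟩
    · intro v hv
      have : g⁻¹ v = v := by rw [Perm.inv_eq_iff_eq]; exact (hgS v hv).1.symm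
      simp only [Perm.mul_apply, this, hm.1.2 v hv]
      exact (hgS v hv).2
    · simp [Perm.mul_apply, hm.2]
  · intro a _ b _ h
    simpa using h

lemma conj_evs {n l i : ℕ} {m0 : Perm (Fin n)} {S : Finset (Fin n)} (g : Perm (Fin n))
    (hg : ∀ u, pcol n l (g u) = pcol n l u) (hgS : ∀ u ∈ S, g u = u ∧ g (m0 u) = m0 u) (x y : Fin n) :
    ((evs n l i m0 S).filter (fun m => m x = y)).card =
      ((evs n l i m0 S).filter (fun m => m (g x) = g y)).card := by
  apply le_antisymm (conj_evs_le g hg hgS x y)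
  have := conj_evs_le (i := i) (m0 := m0) (S := S) g⁻¹ (by intro u; rw [← hg]; simp)
    (by intro u hu
        refine ⟨?_, ?_⟩
        · rw [Perm.inv_eq_iff_eq]; exact (hgS u hu).1.symm
        · rw [Perm.inv_eq_iff_eq]; exact (hgS u hu).2.symm) (g x) (g y)
  simpa using this

lemma pcol_card {n l : ℕ} (h : 2 * l ≤ n) (c : Fin 3) (hc : c ≠ 2) :
    (Finset.univ.filter (fun v : Fin n => pcol n l v = c)).card = l := by
  have h0 : ∀ a, a + l ≤ n → (Finset.univ.filter (fun v : Fin n => a ≤ v.1 ∧ v.1 < a + l)).card = l := by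
    intro a ha
    rw [← Finset.card_map Fin.valEmbedding]
    rw [show Finset.map Fin.valEmbedding (Finset.univ.filter (fun v : Fin n => a ≤ v.1 ∧ v.1 < a + l)) = Finset.Ico a (a+l) from ?_]
    · simp
    · ext x
      simp only [Finset.mem_map, Finset.mem_filter, Finset.mem_univ, true_and, Fin.valEmbedding_apply, Finset.mem_Ico]
      constructor
      · rintro ⟨v, hv, rfl⟩; exact hv
      · intro hx; exact ⟨⟨x, by omega⟩, hx, rfl⟩
  have hc' : c = 0 ∨ c = 1 := by revert hc; revert c; decide
  rcases hc' with rfl | rfl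
  · refine Eq.trans ?_ (h0 0 (by omega)); congr 1; ext v
    simp only [Finset.mem_filter, Finset.mem_univ, true_and]
    unfold pcol
    split_ifs <;> simp <;> omega
  · refine Eq.trans ?_ (h0 l (by omega)); congr 1; ext v
    simp only [Finset.mem_filter, Finset.mem_univ, true_and]
    unfold pcol
    split_ifs <;> simp <;> omega

lemma pcount {n l i : ℕ} (h : 2 * l ≤ n) {m : Perm (Fin n)} (hm : m ∈ PMi n l i) (c c' : Fin 3)
    (hc : c ≠ 2) (hc' : c' ≠ 2) :
    ((Finset.univ.filter (fun v : Fin n => pcol n l v = c ∧ pcol n l (m v) = c')).card : ℝ)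
      = if c = c' then (l:ℝ) - i else i := by
  rw [mem_PMi] at hm
  obtain ⟨hm, hi⟩ := hm
  have h01 : (Finset.univ.filter (fun v : Fin n => pcol n l v = 0 ∧ pcol n l (m v) = 1)).card = i := hi
  have h10 : (Finset.univ.filter (fun v : Fin n => pcol n l v = 1 ∧ pcol n l (m v) = 0)).card = i := by
    rw [← h01]
    refine Finset.card_bij (fun v _ => m v) ?_ ?_ ?_
    · intro v hv
      simp only [Finset.mem_filter, Finset.mem_univ, true_and, hm.1] at hv ⊢
      exact hv.symm
    · intro a _ b _ h; exact m.injective h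
    · intro v hv
      simp only [Finset.mem_filter, Finset.mem_univ, true_and] at hv ⊢
      exact ⟨m v, by rw [hm.1]; exact hv.symm, hm.1 v⟩
  have hsum : ∀ c : Fin 3, c ≠ 2 →
     (Finset.univ.filter (fun v : Fin n => pcol n l v = c ∧ pcol n l (m v) = 0)).card +
     (Finset.univ.filter (fun v : Fin n => pcol n l v = c ∧ pcol n l (m v) = 1)).card = l := by
    intro c hc
    refine Eq.trans ?_ (pcol_card h c hc)
    rw [← Finset.card_union_of_disjoint]
    · congr 1
      ext v
      simp only [Finset.mem_union, Finset.mem_filter, Finset.mem_univ, true_and]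
      constructor
      · rintro (h | h) <;> exact h.1
      · intro hv
        have h2 : pcol n l (m v) ≠ 2 := by rw [Ne, isPM_col hm, hv]; exact hc
        have : ∀ d : Fin 3, d ≠ 2 → d = 0 ∨ d = 1 := by decide
        rcases this _ h2 with h | h
        · exact Or.inl ⟨hv, h⟩
        · exact Or.inr ⟨hv, h⟩
    · rw [Finset.disjoint_left]
      intro v hv hv'
      simp only [Finset.mem_filter, Finset.mem_univ, true_and] at hv hv'
      rw [hv.2] at hv'
      exact absurd hv'.2 (by decide)
  have key : ∀ d : Fin 3, d ≠ 2 → d = 0 ∨ d = 1 := by decide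
  have s0 := hsum 0 (by decide)
  have s1 := hsum 1 (by decide)
  rw [h01] at s0
  rw [h10] at s1
  have s0' : ((Finset.univ.filter (fun v : Fin n => pcol n l v = 0 ∧ pcol n l (m v) = 0)).card : ℝ) + i = l := by exact_mod_cast s0
  have s1' : (i:ℝ) + ((Finset.univ.filter (fun v : Fin n => pcol n l v = 1 ∧ pcol n l (m v) = 1)).card : ℝ) = l := by exact_mod_cast s1
  rcases key c hc with rfl | rfl <;> rcases key c' hc' with rfl | rfl
  · simp only [if_true]; linarith
  · rw [h01]; simp
  · rw [h10]; simp
  · simp only [if_true]; linarith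

open Classical in
lemma evs_step {n l i : ℕ} (h : 2 * l ≤ n) {m0 : Perm (Fin n)} (hm0 : IsPM n l m0) (S : Finset (Fin n))
    (v : Fin n) (hv : v ∉ S) (hw : m0 v ∉ S) (hc : pcol n l v ≠ 2) :
    (((Finset.univ : Finset (Fin n × Fin n)).filter (fun q => pcol n l q.1 = pcol n l v ∧
        pcol n l q.2 = pcol n l (m0 v) ∧ q.1 ≠ q.2 ∧ q.1 ∉ S ∪ S.image m0 ∧ q.2 ∉ S ∪ S.image m0)).card : ℝ) *
      ((evs n l i m0 (insert v S)).card : ℝ) =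
      ((if pcol n l v = pcol n l (m0 v) then (l:ℝ) - i else i) -
        (((S ∪ S.image m0).filter (fun x => pcol n l x = pcol n l v ∧ pcol n l (m0 x) = pcol n l (m0 v))).card : ℝ)) *
      ((evs n l i m0 S).card : ℝ) := by
  set T := S ∪ S.image m0 with hT
  set D := (Finset.univ : Finset (Fin n × Fin n)).filter (fun q => pcol n l q.1 = pcol n l v ∧
        pcol n l q.2 = pcol n l (m0 v) ∧ q.1 ≠ q.2 ∧ q.1 ∉ T ∧ q.2 ∉ T) with hD
  set w := m0 v with hwdef
  have hcw : pcol n l w ≠ 2 := by rw [Ne, isPM_col hm0]; exact hc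
  have hvw : v ≠ w := fun h => hc ((hm0.2 v).1 h.symm)
  have hTclosed : ∀ u ∈ T, m0 u ∈ T := by
    intro u hu
    rw [hT, Finset.mem_union, Finset.mem_image] at hu ⊢
    rcases hu with hu | ⟨u', hu', rfl⟩
    · exact Or.inr ⟨u, hu, rfl⟩
    · left; rw [hm0.1]; exact hu'
  have hvT : v ∉ T := by
    rw [hT, Finset.mem_union, Finset.mem_image, not_or]
    refine ⟨hv, ?_⟩
    rintro ⟨u, hu, rfl⟩
    rw [hwdef, hm0.1] at hw
    exact hw hu
  have hwT : w ∉ T := by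
    intro h1
    have := hTclosed w h1
    rw [hwdef, hm0.1] at this
    exact hvT this
  have hsym : ∀ q ∈ D, ((evs n l i m0 S).filter (fun m => m q.1 = q.2)).card = (evs n l i m0 (insert v S)).card := by
    rintro ⟨x, y⟩ hq
    simp only [hD, Finset.mem_filter, Finset.mem_univ, true_and] at hq
    obtain ⟨hx, hy, hxy, hxT, hyT⟩ := hq
    have hswap : ∀ a b : Fin n, pcol n l a = pcol n l b → ∀ u, pcol n l (swap a b u) = pcol n l u := by
      intro a b hab u
      rw [swap_apply_def]
      split_ifs with h1 h2
      · rw [h1, hab]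
      · rw [h2, hab]
      · rfl
    set y' := swap x v y with hy'
    have hy'c : pcol n l y' = pcol n l w := by rw [hy', hswap x v hx, hy]
    have hy'v : y' ≠ v := by
      intro h1
      apply hxy
      have := congrArg (swap x v) h1
      rw [hy'] at this
      simpa using this.symm
    have hy'T : y' ∉ T := by
      rw [hy', swap_apply_def]
      split_ifs
      · exact hvT
      · exact hxT
      · exact hyT
    have hfix : ∀ u ∈ T, (swap y' w * swap x v) u = u := by
      intro u hu
      rw [Perm.mul_apply, swap_apply_of_ne_of_ne (a := x), swap_apply_of_ne_of_ne]
      all_goals rintro rfl; contradiction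
    rw [conj_evs (swap y' w * swap x v) ?_ ?_ x y]
    · have e1 : (swap y' w * swap x v) x = v := by
        rw [Perm.mul_apply, swap_apply_left, swap_apply_of_ne_of_ne hy'v.symm hvw]
      have e2 : (swap y' w * swap x v) y = w := by
        rw [Perm.mul_apply, ← hy', swap_apply_left]
      rw [e1, e2]
      congr 1
      ext m
      simp only [evs, Finset.mem_filter, Finset.mem_insert, forall_eq_or_imp]
      tauto
    · intro u
      rw [Perm.mul_apply, hswap _ _ hy'c, hswap _ _ hx]
    · intro u hu
      have : u ∈ T := by rw [hT]; exact Finset.mem_union_left _ hu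
      exact ⟨hfix u this, hfix _ (hTclosed u this)⟩
  have hcount : ∀ m ∈ evs n l i m0 S, ((D.filter (fun q => m q.1 = q.2)).card : ℝ) =
      (if pcol n l v = pcol n l w then (l:ℝ) - i else i) -
        ((T.filter (fun x => pcol n l x = pcol n l v ∧ pcol n l (m0 x) = pcol n l w)).card : ℝ) := by
    intro m hm
    simp only [evs, Finset.mem_filter] at hm
    obtain ⟨hmi, hmS⟩ := hm
    have hmP := (mem_PMi.1 hmi).1
    rw [← pcount h hmi _ _ hc hcw, eq_sub_iff_add_eq]
    have hmT : ∀ u ∈ T, m u = m0 u := by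
      intro u hu
      rw [hT, Finset.mem_union, Finset.mem_image] at hu
      rcases hu with hu | ⟨u', hu', rfl⟩
      · exact hmS u hu
      · rw [← hmS u' hu', hmP.1, hmS u' hu', hm0.1]
    have hmT' : ∀ u, m u ∈ T → u ∈ T := by
      intro u hu
      have h1 := hmT _ hu
      rw [hmP.1] at h1
      rw [h1]; exact hTclosed _ hu
    have e1 : (D.filter (fun q => m q.1 = q.2)).card =
        (Finset.univ.filter (fun x => (pcol n l x = pcol n l v ∧ pcol n l (m x) = pcol n l w) ∧ x ∉ T)).card := by
      refine Finset.card_bij (fun q _ => q.1) ?_ ?_ ?_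
      · rintro ⟨x, y⟩ hq
        simp only [hD, Finset.mem_filter, Finset.mem_univ, true_and] at hq ⊢
        obtain ⟨⟨h1, h2, h3, h4, h5⟩, h6⟩ := hq
        rw [h6]
        exact ⟨⟨h1, h2⟩, h4⟩
      · rintro ⟨x, y⟩ hq ⟨x', y'⟩ hq' hh
        simp only [hD, Finset.mem_filter, Finset.mem_univ, true_and] at hq hq' hh
        subst hh
        rw [← hq.2, ← hq'.2]
      · intro x hx
        simp only [Finset.mem_filter, Finset.mem_univ, true_and] at hx
        refine ⟨(x, m x), ?_, rfl⟩
        simp only [hD, Finset.mem_filter, Finset.mem_univ, true_and, and_true]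
        refine ⟨hx.1.1, hx.1.2, ?_, hx.2, fun hh => hx.2 (hmT' x hh)⟩
        intro hh
        have := (hmP.2 x).1 hh.symm
        rw [hx.1.1] at this
        exact hc this
    have e2 : (T.filter (fun x => pcol n l x = pcol n l v ∧ pcol n l (m0 x) = pcol n l w)).card =
        (Finset.univ.filter (fun x => (pcol n l x = pcol n l v ∧ pcol n l (m x) = pcol n l w) ∧ ¬ x ∉ T)).card := by
      congr 1
      ext x
      simp only [Finset.mem_filter, Finset.mem_univ, true_and, not_not]
      constructor
      · rintro ⟨h1, h2⟩
        rw [hmT x h1]; exact ⟨h2, h1⟩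
      · rintro ⟨h2, h1⟩
        rw [hmT x h1] at h2; exact ⟨h1, h2⟩
    have e3 := Finset.card_filter_add_card_filter_not (s := Finset.univ.filter (fun x => pcol n l x = pcol n l v ∧ pcol n l (m x) = pcol n l w)) (fun x => x ∉ T)
    rw [Finset.filter_filter, Finset.filter_filter] at e3
    rw [e1, e2]
    exact_mod_cast e3
  have hdc := Finset.sum_card_bipartiteAbove_eq_sum_card_bipartiteBelow (s := D) (t := evs n l i m0 S)
    (fun q m => m q.1 = q.2)
  simp only [Finset.bipartiteAbove, Finset.bipartiteBelow] at hdc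
  rw [Finset.sum_congr rfl hsym, Finset.sum_const, smul_eq_mul] at hdc
  have hdc' : (D.card : ℝ) * ((evs n l i m0 (insert v S)).card : ℝ) =
    ∑ m ∈ evs n l i m0 S, ((D.filter (fun q => m q.1 = q.2)).card : ℝ) := by exact_mod_cast hdc
  rw [hdc', Finset.sum_congr rfl hcount, Finset.sum_const, nsmul_eq_mul, mul_comm]

open Polynomial in
lemma evs_poly {n l : ℕ} (h : 2 * l ≤ n) {m0 : Perm (Fin n)} (hm0 : IsPM n l m0) (S : Finset (Fin n)) :
    ∃ P : ℝ[X], P.natDegree ≤ S.card ∧ (∀ i : ℕ, ((evs n l i m0 S).card : ℝ) = P.eval (i:ℝ) * ((PMi n l i).card : ℝ)) ∧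
      0 ≤ P.eval 0 ∧ ((∃ v ∈ S, pcol n l v ≠ pcol n l (m0 v)) → P.eval 0 = 0) := by
  classical
  induction S using Finset.induction_on with
  | empty =>
    refine ⟨1, by simp, ?_, by simp, by simp⟩
    intro i; simp [evs]
  | insert v S hv ih =>
    obtain ⟨P, hdeg, hev, h0, hz⟩ := ih
    by_cases hcase : m0 v ∈ S ∨ pcol n l v = 2
    · refine ⟨P, hdeg.trans (Finset.card_le_card (Finset.subset_insert _ _)), ?_, h0, ?_⟩
      · intro i
        rw [← hev]
        congr 2
        ext m
        simp only [evs, Finset.mem_filter, Finset.mem_insert, forall_eq_or_imp]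
        constructor
        · rintro ⟨h1, h2, h3⟩; exact ⟨h1, h3⟩
        · rintro ⟨h1, h3⟩
          refine ⟨h1, ?_, h3⟩
          have hm := (mem_PMi.1 h1).1
          rcases hcase with hc | hc
          · have := h3 _ hc
            rw [hm0.1] at this
            rw [← hm.1 (m0 v), this]
          · rw [(hm.2 v).2 hc, (hm0.2 v).2 hc]
      · rintro ⟨u, hu, huc⟩
        apply hz
        rcases Finset.mem_insert.1 hu with rfl | hu
        · rcases hcase with hc | hc
          · exact ⟨_, hc, by rw [hm0.1]; exact huc.symm⟩
          · rw [(hm0.2 u).2 hc] at huc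
            exact absurd rfl huc
        · exact ⟨u, hu, huc⟩
    · push Not at hcase
      obtain ⟨hw, hc⟩ := hcase
      have hstep := fun i => evs_step (i := i) h hm0 S v hv hw hc
      set D := (Finset.univ : Finset (Fin n × Fin n)).filter (fun q => pcol n l q.1 = pcol n l v ∧
        pcol n l q.2 = pcol n l (m0 v) ∧ q.1 ≠ q.2 ∧ q.1 ∉ S ∪ S.image m0 ∧ q.2 ∉ S ∪ S.image m0) with hD
      set A := (S ∪ S.image m0).filter (fun x => pcol n l x = pcol n l v ∧ pcol n l (m0 x) = pcol n l (m0 v)) with hA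
      have hDpos : (0:ℝ) < D.card := by
        rw [Nat.cast_pos, Finset.card_pos]
        refine ⟨(v, m0 v), ?_⟩
        simp only [hD, Finset.mem_filter, Finset.mem_univ, true_and, Finset.mem_union, Finset.mem_image, not_or]
        refine ⟨fun h => hc ((hm0.2 v).1 h.symm), ⟨hv, ?_⟩, hw, ?_⟩
        · rintro ⟨u, hu, rfl⟩
          rw [hm0.1] at hw; exact hw hu
        · rintro ⟨u, hu, huv⟩
          exact hv (m0.injective huv ▸ hu)
      have hAl : (A.card : ℝ) ≤ l := by
        rw [Nat.cast_le]
        refine le_trans (Finset.card_le_card ?_) (pcol_card h (pcol n l v) hc).le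
        intro x hx
        simp only [hA, Finset.mem_filter, Finset.mem_univ, true_and] at hx ⊢
        exact hx.2.1
      have hcard : (insert v S).card = S.card + 1 := Finset.card_insert_of_notMem hv
      by_cases hcc : pcol n l v = pcol n l (m0 v)
      · refine ⟨C ((D.card:ℝ)⁻¹) * ((C ((l:ℝ) - A.card) - X) * P), ?_, ?_, ?_, ?_⟩
        · rw [hcard]
          refine (natDegree_C_mul_le _ _).trans (natDegree_mul_le.trans ?_)
          have : (C ((l:ℝ) - A.card) - X : ℝ[X]).natDegree ≤ 1 := by compute_degree
          omega
        · intro i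
          have := hstep i
          rw [if_pos hcc, hev] at this
          simp only [eval_mul, eval_C, eval_sub, eval_X]
          field_simp
          linear_combination this
        · simp only [eval_mul, eval_C, eval_sub, eval_X]
          have : 0 ≤ (l:ℝ) - A.card - 0 := by linarith
          positivity
        · rintro ⟨u, hu, huc⟩
          rcases Finset.mem_insert.1 hu with rfl | hu
          · exact absurd hcc huc
          · simp [hz ⟨u, hu, huc⟩]
      · have hz0 : (C ((D.card:ℝ)⁻¹) * ((X - C (A.card:ℝ)) * P)).eval 0 = 0 := by
          rcases Finset.eq_empty_or_nonempty A with hAe | ⟨x, hx⟩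
          · simp [hAe]
          · have : P.eval 0 = 0 := by
              apply hz
              simp only [hA, Finset.mem_filter, Finset.mem_union, Finset.mem_image] at hx
              obtain ⟨hx, hx1, hx2⟩ := hx
              rcases hx with hx | ⟨u, hu, rfl⟩
              · exact ⟨x, hx, by rw [hx1, hx2]; exact hcc⟩
              · refine ⟨u, hu, ?_⟩
                rw [hm0.1] at hx2
                rw [hx1, hx2]; exact fun h => hcc h.symm
            simp [this]
        refine ⟨C ((D.card:ℝ)⁻¹) * ((X - C (A.card:ℝ)) * P), ?_, ?_, hz0.ge, fun _ => hz0⟩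
        · rw [hcard]
          refine (natDegree_C_mul_le _ _).trans (natDegree_mul_le.trans ?_)
          have : (X - C (A.card:ℝ) : ℝ[X]).natDegree ≤ 1 := by compute_degree
          omega
        · intro i
          have := hstep i
          rw [if_neg hcc, hev] at this
          simp only [eval_mul, eval_C, eval_sub, eval_X]
          field_simp
          linear_combination this

end Comb

section Poly
open Equiv

def pmFun (n l i : ℕ) (h : 2 * l ≤ n) (hi : i ≤ l) (hl : l % 2 = 1) (v : Fin n) : Fin n :=
  if h1 : v.1 < i then ⟨v.1 + l, by omega⟩
  else if h2 : v.1 < l then (if h3 : v.1 % 2 = 1 then ⟨v.1 + 1, by omega⟩ else ⟨v.1 - 1, by omega⟩)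
  else if h4 : v.1 < 2 * l then
    (if h5 : v.1 < l + i then ⟨v.1 - l, by omega⟩ else
      if h6 : v.1 % 2 = 0 then ⟨v.1 + 1, by omega⟩ else ⟨v.1 - 1, by omega⟩)
  else v

lemma pmFun_val (n l i : ℕ) (h : 2 * l ≤ n) (hi : i ≤ l) (hl : l % 2 = 1) (v : Fin n) :
    (pmFun n l i h hi hl v).1 =
    if v.1 < i then v.1 + l
    else if v.1 < l then (if v.1 % 2 = 1 then v.1 + 1 else v.1 - 1)
    else if v.1 < 2 * l then
      (if v.1 < l + i then v.1 - l else if v.1 % 2 = 0 then v.1 + 1 else v.1 - 1)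
    else v.1 := by
  unfold pmFun
  split_ifs <;> rfl

lemma pmFun_inv (n l i : ℕ) (h : 2 * l ≤ n) (hi : i ≤ l) (hl : l % 2 = 1) (hio : i % 2 = 1) :
    Function.Involutive (pmFun n l i h hi hl) := by
  intro v
  apply Fin.ext
  have e1 := pmFun_val n l i h hi hl v
  rw [pmFun_val]
  generalize (pmFun n l i h hi hl v).1 = w at *
  obtain ⟨v, hv⟩ := v
  simp only at *
  split_ifs at e1 <;> subst e1 <;> split_ifs <;> omega

lemma pcol0 {n l : ℕ} {v : Fin n} : pcol n l v = 0 ↔ v.1 < l := by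
  unfold pcol; split_ifs <;> simp <;> omega
lemma pcol1 {n l : ℕ} {v : Fin n} : pcol n l v = 1 ↔ l ≤ v.1 ∧ v.1 < 2 * l := by
  unfold pcol; split_ifs <;> simp <;> omega
lemma pcol2 {n l : ℕ} {v : Fin n} : pcol n l v = 2 ↔ 2 * l ≤ v.1 := by
  unfold pcol; split_ifs <;> simp <;> omega

lemma PMi_nonempty (n l i : ℕ) (h : 2 * l ≤ n) (hi : i ≤ l) (hl : l % 2 = 1) (hio : i % 2 = 1) :
    (PMi n l i).Nonempty := by
  refine ⟨(pmFun_inv n l i h hi hl hio).toPerm, ?_⟩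
  rw [mem_PMi]
  refine ⟨⟨fun v => pmFun_inv n l i h hi hl hio v, ?_⟩, ?_⟩
  · intro v
    rw [pcol2, Function.Involutive.coe_toPerm, Fin.ext_iff, pmFun_val]
    obtain ⟨v, hv⟩ := v
    simp only
    split_ifs <;> omega
  · unfold pcr
    have : (Finset.univ.filter (fun v : Fin n => v.1 < i)).card = i := by
      rw [← Finset.card_map Fin.valEmbedding]
      rw [show Finset.map Fin.valEmbedding (Finset.univ.filter (fun v : Fin n => v.1 < i)) = Finset.range i from ?_]
      · simp
      · ext x
        simp only [Finset.mem_map, Finset.mem_filter, Finset.mem_univ, true_and, Fin.valEmbedding_apply, Finset.mem_range]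
        constructor
        · rintro ⟨v, hv, rfl⟩; exact hv
        · intro hx; exact ⟨⟨x, by omega⟩, hx, rfl⟩
    refine Eq.trans ?_ this
    congr 1; ext v
    simp only [Finset.mem_filter, Finset.mem_univ, true_and]
    rw [pcol0, pcol1, Function.Involutive.coe_toPerm, pmFun_val]
    obtain ⟨v, hv⟩ := v
    simp only
    split_ifs <;> omega

open Polynomial in
lemma lagrange_weights (k : ℕ) : ∃ c : ℕ → ℝ, ∀ P : ℝ[X], P.natDegree ≤ k →
    ∑ j ∈ Finset.range (k+1), c j * P.eval ((2 * j + 1 : ℕ) : ℝ) = P.eval 0 := by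
  refine ⟨fun j => (Lagrange.basis (Finset.range (k+1)) (fun j : ℕ => ((2 * j + 1 : ℕ) : ℝ)) j).eval 0, ?_⟩
  intro P hP
  have hinj : Set.InjOn (fun j : ℕ => ((2 * j + 1 : ℕ) : ℝ)) (Finset.range (k+1) : Set ℕ) := by
    intro a _ b _ hab
    simp only at hab
    have : 2 * a + 1 = 2 * b + 1 := by exact_mod_cast hab
    omega
  have hd : P.degree < (Finset.range (k+1)).card := by
    rw [Finset.card_range]
    refine lt_of_le_of_lt Polynomial.degree_le_natDegree ?_
    exact_mod_cast Nat.lt_succ_of_le hP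
  have := Lagrange.eq_interpolate hinj hd
  conv_rhs => rw [this, Lagrange.interpolate_apply, Polynomial.eval_finsetSum]
  refine Finset.sum_congr rfl fun j _ => ?_
  rw [eval_mul, eval_C, mul_comm]

end Poly

section Chi
open Equiv

open Classical in
noncomputable def pmM {n : ℕ} (m : Perm (Fin n)) : Finset (Edge n) :=
  Finset.univ.filter (fun e => ∃ v, e.1 = s(v, m v))

lemma mem_pmM {n : ℕ} {m : Perm (Fin n)} {e : Edge n} : e ∈ pmM m ↔ ∃ v, e.1 = s(v, m v) := by
  simp [pmM]

lemma pmM_matching {n l : ℕ} {m : Perm (Fin n)} (hm : IsPM n l m) : IsMatching (pmM m) := by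
  intro e he f hf hne v hv
  rw [mem_pmM] at he hf
  obtain ⟨a, ha⟩ := he
  obtain ⟨b, hb⟩ := hf
  have key : ∀ (a : Fin n), v ∈ s(a, m a) → s(a, m a) = s(v, m v) := by
    intro a ha
    rcases Sym2.mem_iff.1 ha with h | h
    · rw [h]
    · rw [h, hm.1, Sym2.eq_swap]
  apply hne
  apply Subtype.ext
  rw [ha, hb]
  rw [ha, hb] at hv
  rw [key a hv.1, key b hv.2]

lemma matching_biUnion {n : ℕ} {M : Finset (Edge n)} (hM : IsMatching M) :
    (M.biUnion (fun e => e.1.toFinset)).card = 2 * M.card := by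
  rw [Finset.card_biUnion]
  · rw [Finset.sum_congr rfl (fun e _ => Sym2.card_toFinset_of_not_isDiag e.1 e.2)]
    simp [mul_comm]
  · intro e he f hf hne
    simp only [Function.onFun]
    rw [Finset.disjoint_left]
    intro v hv hv'
    rw [Sym2.mem_toFinset] at hv hv'
    exact hM e he f hf hne v ⟨hv, hv'⟩

lemma fin3_cases (c : Fin 3) (h : c ≠ 2) : c = 0 ∨ c = 1 := by
  revert h; revert c; decide

lemma pmM_card {n l : ℕ} (h : 2 * l ≤ n) {m : Perm (Fin n)} (hm : IsPM n l m) : (pmM m).card = l := by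
  have h1 := matching_biUnion (pmM_matching hm)
  have h2 : (pmM m).biUnion (fun e => e.1.toFinset) =
      Finset.univ.filter (fun v : Fin n => pcol n l v = 0) ∪ Finset.univ.filter (fun v : Fin n => pcol n l v = 1) := by
    ext v
    simp only [Finset.mem_biUnion, Finset.mem_union, Finset.mem_filter, Finset.mem_univ, true_and, Sym2.mem_toFinset, mem_pmM]
    constructor
    · rintro ⟨e, ⟨a, ha⟩, hv⟩
      apply fin3_cases
      rw [ha] at hv
      have hne : pcol n l a ≠ 2 := by
        rw [Ne, ← hm.2]
        intro h3
        apply e.2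
        rw [ha, h3]
        simp
      rcases Sym2.mem_iff.1 hv with h | h
      · rw [h]; exact hne
      · rw [h, Ne, isPM_col hm]; exact hne
    · intro hv
      have hv2 : pcol n l v ≠ 2 := by rcases hv with h | h <;> rw [h] <;> decide
      refine ⟨⟨s(v, m v), ?_⟩, ⟨v, rfl⟩, by simp⟩
      rw [Sym2.mk_isDiag_iff]
      intro h3
      exact hv2 ((hm.2 v).1 h3.symm)
  rw [h2, Finset.card_union_of_disjoint, pcol_card h 0 (by decide), pcol_card h 1 (by decide)] at h1
  · omega
  · rw [Finset.disjoint_left]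
    intro v hv hv'
    simp only [Finset.mem_filter, Finset.mem_univ, true_and] at hv hv'
    rw [hv] at hv'
    exact absurd hv' (by decide)

lemma charVec_pmM_mem {n l : ℕ} (h : 2 * l ≤ n) {m : Perm (Fin n)} (hm : IsPM n l m) :
    charVec (pmM m) ∈ matchingPolytope n l :=
  subset_convexHull ℝ _ ⟨pmM m, pmM_matching hm, pmM_card h hm, rfl⟩

lemma edgeAction_pmM {n : ℕ} (π m : Perm (Fin n)) :
    edgeAction π (charVec (pmM m)) = charVec (pmM (π * m * π⁻¹)) := by
  funext e
  unfold edgeAction charVec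
  have : edgeMap π⁻¹ e ∈ pmM m ↔ e ∈ pmM (π * m * π⁻¹) := by
    rw [mem_pmM, mem_pmM]
    simp only [edgeMap]
    constructor
    · rintro ⟨v, hv⟩
      refine ⟨π v, ?_⟩
      have := congrArg (Sym2.map π) hv
      rw [Sym2.map_map] at this
      simpa [Perm.mul_apply] using this
    · rintro ⟨v, hv⟩
      refine ⟨π⁻¹ v, ?_⟩
      rw [hv]
      simp [Perm.mul_apply]
  simp only [this]

open Classical in
def badE (n l : ℕ) (e : Edge n) : Prop :=
  (∀ v ∈ e.1, pcol n l v = 0) ∨ (∀ v ∈ e.1, pcol n l v = 1)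

open Classical in
noncomputable def phi (n l : ℕ) : (Edge n → ℝ) →ₗ[ℝ] ℝ :=
  ∑ e ∈ Finset.univ.filter (fun e => ¬ badE n l e), LinearMap.proj e

open Classical in
lemma phi_charVec (n l : ℕ) (M : Finset (Edge n)) :
    phi n l (charVec M) = ((M.filter (fun e => ¬ badE n l e)).card : ℝ) := by
  unfold phi charVec
  simp only [LinearMap.coe_sum, Finset.sum_apply, LinearMap.proj_apply]
  rw [Finset.sum_ite, Finset.sum_const_zero, Finset.sum_const, add_zero, nsmul_eq_mul, mul_one, Finset.filter_filter]
  congr 2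
  ext e
  simp only [Finset.mem_filter, Finset.mem_univ, true_and]
  tauto

lemma matching_sub {n l : ℕ} (h : 2 * l ≤ n) {M : Finset (Edge n)} (hM : IsMatching M) (c : Fin 3) (hc : c ≠ 2)
    (hMc : ∀ e ∈ M, ∀ v ∈ e.1, pcol n l v = c) : 2 * M.card ≤ l := by
  rw [← matching_biUnion hM]
  refine le_trans (Finset.card_le_card ?_) (pcol_card h c hc).le
  intro v hv
  simp only [Finset.mem_biUnion, Sym2.mem_toFinset] at hv
  obtain ⟨e, he, hv⟩ := hv
  simp only [Finset.mem_filter, Finset.mem_univ, true_and]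
  exact hMc e he v hv

lemma phi_ge {n l k : ℕ} (h : 2 * l ≤ n) (hl : l = 2 * k + 1) {x : Edge n → ℝ}
    (hx : x ∈ matchingPolytope n l) : 1 ≤ phi n l x := by
  classical
  have hconv : Convex ℝ {x : Edge n → ℝ | 1 ≤ phi n l x} :=
    convex_halfSpace_ge (phi n l).isLinear 1
  refine convexHull_min ?_ hconv hx
  rintro x ⟨M, hM, hcard, rfl⟩
  show 1 ≤ phi n l (charVec M)
  rw [phi_charVec]
  rw [← Nat.cast_one, Nat.cast_le, Nat.one_le_iff_ne_zero, Finset.card_ne_zero]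
  by_contra hne
  rw [Finset.not_nonempty_iff_eq_empty, Finset.filter_eq_empty_iff] at hne
  have hsub : ∀ N : Finset (Edge n), N ⊆ M → IsMatching N := fun N hN e he f hf => hM e (hN he) f (hN hf)
  have h0 := matching_sub h (hsub (M.filter (fun e => ∀ v ∈ e.1, pcol n l v = 0)) (Finset.filter_subset _ _)) 0 (by decide)
    (fun e he => (Finset.mem_filter.1 he).2)
  have h1 := matching_sub h (hsub (M.filter (fun e => ∀ v ∈ e.1, pcol n l v = 1)) (Finset.filter_subset _ _)) 1 (by decide)
    (fun e he => (Finset.mem_filter.1 he).2)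
  have h2 : M.card ≤ (M.filter (fun e => ∀ v ∈ e.1, pcol n l v = 0)).card + (M.filter (fun e => ∀ v ∈ e.1, pcol n l v = 1)).card := by
    refine le_trans (Finset.card_le_card ?_) (Finset.card_union_le _ _)
    intro e he
    rw [Finset.mem_union, Finset.mem_filter, Finset.mem_filter]
    rcases not_not.1 (hne he) with h | h
    · exact Or.inl ⟨he, h⟩
    · exact Or.inr ⟨he, h⟩
  omega

lemma phi_pmM {n l : ℕ} {m : Perm (Fin n)} (hm : IsPM n l m) :
    phi n l (charVec (pmM m)) = (pcr n l m : ℝ) := by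
  classical
  rw [phi_charVec, Nat.cast_inj, pcr]
  symm
  have hnd : ∀ v, pcol n l v = 0 ∧ pcol n l (m v) = 1 → ¬ (s(v, m v)).IsDiag := by
    intro v hv hd
    rw [Sym2.mk_isDiag_iff] at hd
    rw [← hd, hv.1] at hv
    exact absurd hv.2 (by decide)
  refine Finset.card_bij (fun v hv => ⟨s(v, m v), hnd v (by simpa using hv)⟩) ?_ ?_ ?_
  · intro v hv
    simp only [Finset.mem_filter, Finset.mem_univ, true_and] at hv
    rw [Finset.mem_filter, mem_pmM]
    refine ⟨⟨v, rfl⟩, ?_⟩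
    rintro (h | h)
    · have := h (m v) (by simp)
      rw [hv.2] at this; exact absurd this (by decide)
    · have := h v (by simp)
      rw [hv.1] at this; exact absurd this (by decide)
  · intro a ha b hb hab
    simp only [Finset.mem_filter, Finset.mem_univ, true_and] at ha hb
    simp only [Subtype.mk.injEq] at hab
    rcases Sym2.eq_iff.1 hab with h | h
    · exact h.1
    · exfalso
      rw [h.1, hb.2] at ha
      exact absurd ha.1 (by decide)
  · intro e he
    rw [Finset.mem_filter, mem_pmM] at he
    obtain ⟨⟨v, hv⟩, hb⟩ := he
    have hne : pcol n l v ≠ 2 := by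
      rw [Ne, ← hm.2]
      intro h3
      apply e.2
      rw [hv, h3]
      simp
    have hne' : pcol n l (m v) ≠ 2 := by rw [Ne, isPM_col hm]; exact hne
    unfold badE at hb
    rw [hv] at hb
    simp only [Sym2.mem_iff, forall_eq_or_imp, forall_eq, not_or] at hb
    rcases fin3_cases _ hne with h | h <;> rcases fin3_cases _ hne' with h' | h'
    · exact absurd ⟨h, h'⟩ hb.1
    · exact ⟨v, by simp [h, h'], Subtype.ext hv.symm⟩
    · refine ⟨m v, by simp [h, h', hm.1], Subtype.ext ?_⟩
      rw [hv]
      simp only [hm.1]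
      exact Sym2.eq_swap
    · exact absurd ⟨h, h'⟩ hb.2

end Chi

section Loc
open Equiv

lemma conj_isPM {n l : ℕ} {m : Perm (Fin n)} (g : Perm (Fin n)) (hg : ∀ u, pcol n l (g u) = 2 ↔ pcol n l u = 2)
    (hm : IsPM n l m) : IsPM n l (g * m * g⁻¹) := by
  refine ⟨?_, ?_⟩
  · intro v; simp [Perm.mul_apply, hm.1]
  · intro v
    have : pcol n l v = 2 ↔ pcol n l (g⁻¹ v) = 2 := by rw [← hg (g⁻¹ v)]; simp
    rw [this, ← hm.2]
    simp only [Perm.mul_apply]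
    rw [← Perm.eq_inv_iff_eq]

lemma exists_free {n l k : ℕ} (h : 2 * l ≤ n) (hl : l = 2 * k + 1) {W : Finset (Fin n)} (hW : W.card ≤ k)
    (m : Perm (Fin n)) (hm : IsPM n l m) : ∃ u, u ∉ W ∧ m u ∉ W ∧ m u ≠ u := by
  classical
  have h1 := pcol_card h 0 (by decide)
  have h2 : (W ∪ W.image m).card < (Finset.univ.filter (fun v : Fin n => pcol n l v = 0)).card := by
    rw [h1]
    have a1 := Finset.card_union_le W (W.image m)
    have a2 : (W.image m).card ≤ W.card := Finset.card_image_le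
    omega
  obtain ⟨u, hu, hu'⟩ := Finset.exists_mem_notMem_of_card_lt_card h2
  simp only [Finset.mem_filter, Finset.mem_univ, true_and] at hu
  rw [Finset.mem_union, Finset.mem_image, not_or] at hu'
  refine ⟨u, hu'.1, fun hh => hu'.2 ⟨m u, hh, hm.1 u⟩, ?_⟩
  rw [Ne, hm.2, hu]; decide

lemma loc_any {n l k : ℕ} (h : 2 * l ≤ n) (hl : l = 2 * k + 1) {W : Finset (Fin n)} (hW : W.card ≤ k)
    (f : Perm (Fin n) → ℝ)
    (hf : ∀ π : Perm (Fin n), Perm.sign π = 1 → (∀ v ∈ W, π v = v) → ∀ m, IsPM n l m → f (π * m * π⁻¹) = f m)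
    (τ : Perm (Fin n)) (hτ : ∀ v ∈ W, τ v = v) (m : Perm (Fin n)) (hm : IsPM n l m) :
    f (τ * m * τ⁻¹) = f m := by
  rcases Int.units_eq_one_or (Perm.sign τ) with hs | hs
  · exact hf τ hs hτ m hm
  · obtain ⟨u, hu, hmu, hne⟩ := exists_free h hl hW m hm
    have h1 := hf (τ * swap u (m u)) (by rw [Perm.sign_mul, hs, Perm.sign_swap hne.symm]; rfl) ?_ m hm
    · rw [← h1]
      congr 1
      have h2 : m * swap u (m u) = swap u (m u) * m := by
        rw [mul_swap_eq_swap_mul, hm.1, swap_comm]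
      have h3 : τ * swap u (m u) * m * (τ * swap u (m u))⁻¹ = τ * (swap u (m u) * m) * (swap u (m u))⁻¹ * τ⁻¹ := by
        group
      rw [h3, ← h2]
      group
    · intro v hv
      rw [Perm.mul_apply, swap_apply_of_ne_of_ne, hτ v hv]
      · rintro rfl; exact hu hv
      · rintro rfl; exact hmu hv

lemma loc_dep {n l k : ℕ} (h : 2 * l ≤ n) (hl : l = 2 * k + 1) {W : Finset (Fin n)} (hW : W.card ≤ k)
    (f : Perm (Fin n) → ℝ)
    (hf : ∀ π : Perm (Fin n), Perm.sign π = 1 → (∀ v ∈ W, π v = v) → ∀ m, IsPM n l m → f (π * m * π⁻¹) = f m)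
    (m' : Perm (Fin n)) (hm' : IsPM n l m') :
    ∀ (N : ℕ) (m : Perm (Fin n)), IsPM n l m → (Finset.univ.filter (fun v => m v ≠ m' v)).card ≤ N →
      (∀ v ∈ W, m v = m' v) → f m = f m' := by
  intro N
  induction N with
  | zero =>
    intro m hm hc _
    rw [Nat.le_zero, Finset.card_eq_zero, Finset.filter_eq_empty_iff] at hc
    have : m = m' := by
      ext v
      have := hc (Finset.mem_univ v)
      rw [not_not] at this
      rw [this]
    rw [this]
  | succ N ih =>
    intro m hm hc hmW
    by_cases hv : ∃ v, m v ≠ m' v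
    swap
    · push Not at hv
      rw [show m = m' from Equiv.ext hv]
    obtain ⟨v, hv⟩ := hv
    have hcv : pcol n l v ≠ 2 := by
      intro hh
      rw [(hm.2 v).2 hh, (hm'.2 v).2 hh] at hv
      exact hv rfl
    set a := m v with ha
    set b := m' v with hb
    have hav : v ≠ a := fun hh => hcv ((hm.2 v).1 hh.symm)
    have hbv : v ≠ b := fun hh => hcv ((hm'.2 v).1 hh.symm)
    have hma : m a = v := hm.1 v
    have hmb : m' b = v := hm'.1 v
    have key : ∀ x, m x = m' x → x ≠ a ∧ x ≠ b := by
      intro x hx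
      constructor
      · rintro rfl
        rw [hma] at hx
        apply hv
        rw [hb, hx, hm'.1]
      · rintro rfl
        rw [hmb] at hx
        apply hv
        rw [ha, ← hx, hm.1]
    have key2 : ∀ x, m x = m' x → (swap a b * m * (swap a b)⁻¹) x = m' x := by
      intro x hx
      obtain ⟨h1, h2⟩ := key x hx
      rw [swap_inv, Perm.mul_apply, Perm.mul_apply, swap_apply_of_ne_of_ne h1 h2, swap_apply_of_ne_of_ne, hx]
      · intro hh
        have hxv := m.injective hh
        exact hv (by rw [ha, hb, ← hxv]; exact hx)
      · rw [hx]
        intro hh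
        have hxv := m'.injective hh
        exact hv (by rw [ha, hb, ← hxv]; exact hx)
    have hca : pcol n l a ≠ 2 := by rw [ha, Ne, isPM_col hm]; exact hcv
    have hcb : pcol n l b ≠ 2 := by rw [hb, Ne, isPM_col hm']; exact hcv
    have hm1 : IsPM n l (swap a b * m * (swap a b)⁻¹) := by
      apply conj_isPM _ _ hm
      intro u
      rw [swap_apply_def]
      split_ifs with h1 h2
      · rw [h1]; exact ⟨fun h => absurd h hcb, fun h => absurd h hca⟩
      · rw [h2]; exact ⟨fun h => absurd h hca, fun h => absurd h hcb⟩
      · rfl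
    have h1 : f (swap a b * m * (swap a b)⁻¹) = f m := by
      apply loc_any h hl hW f hf _ _ m hm
      intro w hw
      obtain ⟨h1, h2⟩ := key w (hmW w hw)
      exact swap_apply_of_ne_of_ne h1 h2
    rw [← h1]
    apply ih _ hm1
    · refine Nat.le_of_lt_succ (lt_of_lt_of_le (Finset.card_lt_card ?_) hc)
      rw [Finset.ssubset_iff_of_subset]
      · refine ⟨v, by simpa using hv, ?_⟩
        simp only [Finset.mem_filter, Finset.mem_univ, true_and, not_not]
        rw [swap_inv, Perm.mul_apply, Perm.mul_apply, swap_apply_of_ne_of_ne hav hbv, ← ha, swap_apply_left]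
      · intro x hx
        simp only [Finset.mem_filter, Finset.mem_univ, true_and] at hx ⊢
        exact fun hh => hx (key2 x hh)
    · intro w hw
      exact key2 w (hmW w hw)

open Polynomial in
lemma L_nonneg {n l k : ℕ} (h : 2 * l ≤ n) (hl : l = 2 * k + 1) {W : Finset (Fin n)} (hW : W.card ≤ k)
    (f : Perm (Fin n) → ℝ) (hpos : ∀ m, IsPM n l m → 0 ≤ f m)
    (hloc : ∀ m m', IsPM n l m → IsPM n l m' → (∀ v ∈ W, m v = m' v) → f m = f m')
    (c : ℕ → ℝ) (hc : ∀ P : ℝ[X], P.natDegree ≤ k →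
      ∑ j ∈ Finset.range (k+1), c j * P.eval ((2 * j + 1 : ℕ) : ℝ) = P.eval 0) :
    0 ≤ ∑ j ∈ Finset.range (k+1), ∑ m ∈ PMi n l (2*j+1), (c j / ((PMi n l (2*j+1)).card : ℝ)) * f m := by
  classical
  set PM := (Finset.univ : Finset (Perm (Fin n))).filter (IsPM n l) with hPM
  set cnt : Perm (Fin n) → ℝ := fun m0 => ((PM.filter (fun m => ∀ v ∈ W, m v = m0 v)).card : ℝ) with hcnt
  have hP := fun m0 : {m // IsPM n l m} => evs_poly h m0.2 W
  choose P hdeg hev h0 _ using hP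
  have hf : ∀ m, IsPM n l m → f m = ∑ m0 ∈ PM, (if ∀ v ∈ W, m v = m0 v then f m0 / cnt m0 else 0) := by
    intro m hm
    rw [← Finset.sum_filter]
    have hset : PM.filter (fun m0 => ∀ v ∈ W, m v = m0 v) = PM.filter (fun m0 => ∀ v ∈ W, m0 v = m v) := by
      ext m0; simp only [Finset.mem_filter, eq_comm]
    have hterm : ∀ m0 ∈ PM.filter (fun m0 => ∀ v ∈ W, m v = m0 v), f m0 / cnt m0 = f m / cnt m := by
      intro m0 hm0
      simp only [hPM, Finset.mem_filter, Finset.mem_univ, true_and] at hm0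
      rw [hloc m m0 hm hm0.1 hm0.2]
      congr 1
      simp only [hcnt]
      congr 2
      ext m1
      simp only [Finset.mem_filter]
      constructor
      · rintro ⟨h1, h2⟩; exact ⟨h1, fun v hv => by rw [h2 v hv, hm0.2 v hv]⟩
      · rintro ⟨h1, h2⟩; exact ⟨h1, fun v hv => by rw [h2 v hv, hm0.2 v hv]⟩
    rw [Finset.sum_congr rfl hterm, Finset.sum_const, nsmul_eq_mul, hset]
    have hne : cnt m ≠ 0 := by
      simp only [hcnt]
      rw [Nat.cast_ne_zero, Finset.card_ne_zero]
      exact ⟨m, by simp [hPM, hm]⟩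
    change f m = cnt m * (f m / cnt m)
    field_simp
  have hsum : ∀ j ∈ Finset.range (k+1), ∑ m ∈ PMi n l (2*j+1), (c j / ((PMi n l (2*j+1)).card : ℝ)) * f m =
      ∑ m0 : {m // IsPM n l m}, (f m0.1 / cnt m0.1) * (c j * (P m0).eval ((2 * j + 1 : ℕ) : ℝ)) := by
    intro j hj
    rw [Finset.mem_range] at hj
    have hne : ((PMi n l (2*j+1)).card : ℝ) ≠ 0 := by
      rw [Nat.cast_ne_zero, Finset.card_ne_zero]
      exact PMi_nonempty n l _ h (by omega) (by omega) (by omega)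
    rw [← Finset.mul_sum, Finset.sum_congr rfl (fun m hm => hf m (mem_PMi.1 hm).1), Finset.sum_comm]
    rw [hPM, Finset.sum_filter, ← Finset.sum_filter, Finset.sum_subtype (p := IsPM n l) _ (by simp), Finset.mul_sum]
    refine Finset.sum_congr rfl fun m0 _ => ?_
    rw [← Finset.sum_filter, Finset.sum_const, nsmul_eq_mul]
    have := hev m0 (2*j+1)
    unfold evs at this
    rw [this]
    field_simp
  rw [Finset.sum_congr rfl hsum, Finset.sum_comm]
  refine Finset.sum_nonneg fun m0 _ => ?_
  rw [← Finset.mul_sum, hc _ ((hdeg m0).trans hW)]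
  refine mul_nonneg (div_nonneg (hpos _ m0.2) (Nat.cast_nonneg _)) (h0 m0)

end Loc

section Sect
open Equiv

lemma affine_sum {E F ι : Type*} [AddCommGroup E] [Module ℝ E] [AddCommGroup F] [Module ℝ F]
    (p : E →ᵃ[ℝ] F) (s : Finset ι) (w : ι → ℝ) (hw : ∑ i ∈ s, w i = 1) (y : ι → E) :
    p (∑ i ∈ s, w i • y i) = ∑ i ∈ s, w i • p (y i) := by
  have hp : ∀ x, p x = p.linear x + p 0 := by
    intro x
    have := p.map_vadd 0 x
    simpa using this
  have h1 : ∀ i ∈ s, w i • p (y i) = w i • p.linear (y i) + w i • p 0 := by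
    intro i _
    rw [hp (y i), smul_add]
  rw [Finset.sum_congr rfl h1, Finset.sum_add_distrib, ← Finset.sum_smul, hw, one_smul, hp, map_sum]
  simp only [map_smul]

lemma affsub_sum {E ι : Type*} [AddCommGroup E] [Module ℝ E] (V : AffineSubspace ℝ E) (s : Finset ι) (w : ι → ℝ)
    (hw : ∑ i ∈ s, w i = 1) (y : ι → E) (hy : ∀ i ∈ s, y i ∈ V) : ∑ i ∈ s, w i • y i ∈ V := by
  have hne : s.Nonempty := by
    rw [Finset.nonempty_iff_ne_empty]
    rintro rfl
    simp at hw
  obtain ⟨i0, hi0⟩ := hne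
  have h1 : ∑ i ∈ s, w i • (y i - y i0) ∈ V.direction :=
    Submodule.sum_mem _ fun i hi => Submodule.smul_mem _ _ (AffineSubspace.vsub_mem_direction (hy i hi) (hy i0 hi0))
  have h2 := AffineSubspace.vadd_mem_of_mem_direction h1 (hy i0 hi0)
  convert h2 using 1
  simp only [smul_sub, Finset.sum_sub_distrib, ← Finset.sum_smul, hw, one_smul, vadd_eq_add]
  abel

lemma edgeMap_mul {n : ℕ} (π τ : Perm (Fin n)) (e : Edge n) : edgeMap (π * τ) e = edgeMap π (edgeMap τ e) := by
  apply Subtype.ext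
  simp only [edgeMap, Sym2.map_map]
  rfl

lemma edgeMap_one {n : ℕ} (e : Edge n) : edgeMap 1 e = e := by
  apply Subtype.ext
  simp [edgeMap]

lemma edgeAction_mul {n : ℕ} (π τ : Perm (Fin n)) (x : Edge n → ℝ) :
    edgeAction (π * τ) x = edgeAction π (edgeAction τ x) := by
  funext e
  simp only [edgeAction, mul_inv_rev, edgeMap_mul]

lemma edgeAction_one {n : ℕ} (x : Edge n → ℝ) : edgeAction 1 x = x := by
  funext e
  simp only [edgeAction, inv_one, edgeMap_one]

lemma coordAction_mul {d : ℕ} (σ ρ : Perm (Fin d)) (y : Fin d → ℝ) :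
    coordAction (σ * ρ) y = coordAction σ (coordAction ρ y) := by
  funext j
  simp only [coordAction, mul_inv_rev, Perm.mul_apply]

lemma coordAction_one {d : ℕ} (y : Fin d → ℝ) : coordAction 1 y = y := by
  funext j
  simp [coordAction]

lemma edge_inv_act {n : ℕ} (π : Perm (Fin n)) (x : Edge n → ℝ) : edgeAction π⁻¹ (edgeAction π x) = x := by
  rw [← edgeAction_mul, inv_mul_cancel, edgeAction_one]
lemma edge_act_inv {n : ℕ} (π : Perm (Fin n)) (x : Edge n → ℝ) : edgeAction π (edgeAction π⁻¹ x) = x := by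
  rw [← edgeAction_mul, mul_inv_cancel, edgeAction_one]
lemma coord_inv_act {n : ℕ} (π : Perm (Fin n)) (x : Fin n → ℝ) : coordAction π⁻¹ (coordAction π x) = x := by
  rw [← coordAction_mul, inv_mul_cancel, coordAction_one]

def Gam {n d : ℕ} (Q : Set (Fin d → ℝ)) (p : (Fin d → ℝ) →ᵃ[ℝ] (Edge n → ℝ)) :
    Subgroup (Perm (Fin n) × Perm (Fin d)) where
  carrier := {g | coordAction g.2 '' Q = Q ∧ ∀ y ∈ Q, p (coordAction g.2 y) = edgeAction g.1 (p y)}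
  mul_mem' := by
    rintro ⟨a, b⟩ ⟨a', b'⟩ ⟨h1, h2⟩ ⟨h3, h4⟩
    refine ⟨?_, ?_⟩
    · have : coordAction (b * b') = coordAction b ∘ coordAction b' := by
        funext y; exact coordAction_mul b b' y
      show coordAction (b * b') '' Q = Q
      rw [this, Set.image_comp, h3, h1]
    · intro y hy
      show p (coordAction (b * b') y) = edgeAction (a * a') (p y)
      rw [coordAction_mul, edgeAction_mul, ← h4 y hy, ← h2]
      rw [← h3]; exact ⟨y, hy, rfl⟩
  one_mem' := by
    refine ⟨?_, ?_⟩
    · have : coordAction (1 : Perm (Fin d)) = id := by funext y; exact coordAction_one y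
      show coordAction (1 : Perm (Fin d)) '' Q = Q
      rw [this, Set.image_id]
    · intro y hy
      show p (coordAction 1 y) = edgeAction 1 (p y)
      rw [coordAction_one, edgeAction_one]
  inv_mem' := by
    rintro ⟨a, b⟩ ⟨h1, h2⟩
    refine ⟨?_, ?_⟩
    · show coordAction b⁻¹ '' Q = Q
      conv_lhs => rw [← h1]
      rw [← Set.image_comp]
      have : coordAction b⁻¹ ∘ coordAction b = id := by funext y; exact coord_inv_act b y
      rw [this, Set.image_id]
    · intro y hy
      show p (coordAction b⁻¹ y) = edgeAction a⁻¹ (p y)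
      have hy' := hy
      rw [← h1] at hy'
      obtain ⟨z, hz, rfl⟩ := hy'
      rw [coord_inv_act, h2 z hz, edge_inv_act]

lemma sect {n d : ℕ} {Q : Set (Fin d → ℝ)} (hQ : Convex ℝ Q) (p : (Fin d → ℝ) →ᵃ[ℝ] (Edge n → ℝ))
    (hsym : ∀ π : Perm (Fin n), ∃ σ : Perm (Fin d), coordAction σ '' Q = Q ∧
        ∀ y ∈ Q, p (coordAction σ y) = edgeAction π (p y)) :
    (∀ π : Perm (Fin n), ∀ x ∈ p '' Q, edgeAction π x ∈ p '' Q) ∧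
    ∃ s : (Edge n → ℝ) → (Fin d → ℝ), (∀ x ∈ p '' Q, s x ∈ Q ∧ p (s x) = x) ∧
      ∀ π : Perm (Fin n), ∃ σ : Perm (Fin d), ∀ x ∈ p '' Q, s (edgeAction π x) = coordAction σ (s x) := by
  classical
  have hinv : ∀ π : Perm (Fin n), ∀ x ∈ p '' Q, edgeAction π x ∈ p '' Q := by
    rintro π _ ⟨y, hy, rfl⟩
    obtain ⟨σ, h1, h2⟩ := hsym π
    refine ⟨coordAction σ y, ?_, h2 y hy⟩
    rw [← h1]; exact ⟨y, hy, rfl⟩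
  refine ⟨hinv, ?_⟩
  have hy : ∀ x : Edge n → ℝ, ∃ y : Fin d → ℝ, x ∈ p '' Q → y ∈ Q ∧ p y = x := by
    intro x
    by_cases hx : x ∈ p '' Q
    · obtain ⟨y, h1, h2⟩ := hx
      exact ⟨y, fun _ => ⟨h1, h2⟩⟩
    · exact ⟨0, fun h => absurd h hx⟩
  choose y hy using hy
  set w : ℝ := ((Fintype.card (Gam Q p) : ℝ))⁻¹ with hw
  have hw1 : ∑ g : Gam Q p, w = 1 := by
    rw [Finset.sum_const, nsmul_eq_mul, Finset.card_univ, hw]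
    exact mul_inv_cancel₀ (by exact_mod_cast Fintype.card_ne_zero)
  have hw0 : 0 ≤ w := by rw [hw]; positivity
  have hterm : ∀ x ∈ p '' Q, ∀ g : Gam Q p, coordAction g.1.2 (y (edgeAction g.1.1⁻¹ x)) ∈ Q ∧
      p (coordAction g.1.2 (y (edgeAction g.1.1⁻¹ x))) = x := by
    intro x hx g
    obtain ⟨⟨a, b⟩, h1, h2⟩ := g
    obtain ⟨h3, h4⟩ := hy _ (hinv a⁻¹ x hx)
    refine ⟨?_, ?_⟩
    · simp only at h1 ⊢
      rw [← h1]; exact ⟨_, h3, rfl⟩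
    · simp only at h2 ⊢
      rw [h2 _ h3, h4, edge_act_inv]
  refine ⟨fun x => ∑ g : Gam Q p, w • coordAction g.1.2 (y (edgeAction g.1.1⁻¹ x)), ?_, ?_⟩
  · intro x hx
    refine ⟨?_, ?_⟩
    · exact hQ.sum_mem (fun _ _ => hw0) hw1 (fun g _ => (hterm x hx g).1)
    · simp only
      rw [affine_sum p _ (fun _ => w) hw1, Finset.sum_congr rfl (fun g _ => by rw [(hterm x hx g).2]),
        ← Finset.sum_smul, hw1, one_smul]
  · intro π
    obtain ⟨σ, h1, h2⟩ := hsym π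
    refine ⟨σ, fun x hx => ?_⟩
    let g0 : Gam Q p := ⟨(π, σ), h1, h2⟩
    funext j
    simp only [coordAction, Finset.sum_apply, Pi.smul_apply]
    rw [← Equiv.sum_comp (Equiv.mulLeft g0)]
    refine Finset.sum_congr rfl fun g _ => ?_
    have e1 : ((Equiv.mulLeft g0) g).1.1 = π * g.1.1 := rfl
    have e2 : ((Equiv.mulLeft g0) g).1.2 = σ * g.1.2 := rfl
    rw [e1, e2, mul_inv_rev, mul_inv_rev, edgeAction_mul, edge_inv_act, Perm.mul_apply]

end Sect

section Main
open Equiv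

/-- stabilizer-type subgroup of a coordinate of the section -/
def Hj {n d : ℕ} (P : Set (Edge n → ℝ)) (hP : ∀ π : Perm (Fin n), ∀ x ∈ P, edgeAction π x ∈ P)
    (s : (Edge n → ℝ) → (Fin d → ℝ)) (j : Fin d) : Subgroup (Perm (Fin n)) where
  carrier := {π | ∀ x ∈ P, s (edgeAction π x) j = s x j}
  mul_mem' := by
    intro a b ha hb x hx
    rw [edgeAction_mul, ha _ (hP b x hx), hb x hx]
  one_mem' := by
    intro x hx
    rw [edgeAction_one]
  inv_mem' := by
    intro a ha x hx
    have := ha _ (hP a⁻¹ x hx)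
    rw [edge_act_inv] at this
    exact this.symm

lemma Hj_index {n d : ℕ} (P : Set (Edge n → ℝ)) (hP : ∀ π : Perm (Fin n), ∀ x ∈ P, edgeAction π x ∈ P)
    (s : (Edge n → ℝ) → (Fin d → ℝ))
    (hs : ∀ π : Perm (Fin n), ∃ σ : Perm (Fin d), ∀ x ∈ P, s (edgeAction π x) = coordAction σ (s x))
    (j : Fin d) : (Hj P hP s j).index ≤ d := by
  choose σ hσ using hs
  have hinj : Function.Injective (fun q : Perm (Fin n) ⧸ Hj P hP s j => (σ (q.out)⁻¹)⁻¹ j) := by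
    intro q q' hqq
    simp only at hqq
    rw [← QuotientGroup.out_eq' q, ← QuotientGroup.out_eq' q', QuotientGroup.eq]
    intro x hx
    have hx' := hP q'.out x hx
    rw [edgeAction_mul, hσ _ _ hx']
    have h2 : s x = coordAction (σ q'.out⁻¹) (s (edgeAction q'.out x)) := by
      rw [← hσ _ _ hx', edge_inv_act]
    conv_rhs => rw [h2]
    simp only [coordAction]
    rw [hqq]
  have := Nat.card_le_card_of_injective _ hinj
  rw [Nat.card_fin] at this
  exact this

open Polynomial in
lemma main_case (n l k : ℕ) (hk : 2 ≤ k) (hodd : l = 2 * k + 1) (hln : 2 * l ≤ n)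
    (d : ℕ) (hd : d ≤ Nat.choose n k) (V : AffineSubspace ℝ (Fin d → ℝ)) (Q : Set (Fin d → ℝ))
    (hQ : Q = {y : Fin d → ℝ | y ∈ V ∧ ∀ j, 0 ≤ y j})
    (p : (Fin d → ℝ) →ᵃ[ℝ] (Edge n → ℝ)) (hp : p '' Q = matchingPolytope n l)
    (hsym : ∀ π : Equiv.Perm (Fin n), ∃ σ : Equiv.Perm (Fin d),
        coordAction σ '' Q = Q ∧ ∀ y ∈ Q, p (coordAction σ y) = edgeAction π (p y)) : False := by
  classical
  have hconv : Convex ℝ Q := by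
    have h1 : Convex ℝ (V : Set (Fin d → ℝ)) := V.convex
    have h2 : Convex ℝ {y : Fin d → ℝ | 0 ≤ y} := convex_Ici 0
    have h3 : Q = (V : Set (Fin d → ℝ)) ∩ {y : Fin d → ℝ | 0 ≤ y} := by
      rw [hQ]; rfl
    rw [h3]; exact h1.inter h2
  obtain ⟨hinv, s, hs1, hs2⟩ := sect hconv p hsym
  have hmem : ∀ m, IsPM n l m → charVec (pmM m) ∈ p '' Q := by
    intro m hm
    rw [hp]; exact charVec_pmM_mem hln hm
  obtain ⟨c, hc⟩ := lagrange_weights k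
  have hne : ∀ j ∈ Finset.range (k+1), ((PMi n l (2*j+1)).card : ℝ) ≠ 0 := by
    intro j hj
    rw [Finset.mem_range] at hj
    rw [Nat.cast_ne_zero, Finset.card_ne_zero]
    exact PMi_nonempty n l _ hln (by omega) (by omega) (by omega)
  -- nonnegativity of coordinates
  have hnn : ∀ j : Fin d, 0 ≤ ∑ i ∈ Finset.range (k+1), ∑ m ∈ PMi n l (2*i+1),
      (c i / ((PMi n l (2*i+1)).card : ℝ)) * s (charVec (pmM m)) j := by
    intro j
    obtain ⟨W, hW, hWH⟩ := grp_main k (Fin n) (Hj (p '' Q) hinv s j)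
      (by rw [Fintype.card_fin]; omega) (by rw [Fintype.card_fin]; omega)
      (by rw [Fintype.card_fin]; exact (Hj_index _ hinv s hs2 j).trans hd)
    have hpos : ∀ m, IsPM n l m → 0 ≤ s (charVec (pmM m)) j := by
      intro m hm
      have := (hs1 _ (hmem m hm)).1
      rw [hQ] at this
      exact this.2 j
    refine L_nonneg hln hodd hW (fun m => s (charVec (pmM m)) j) hpos ?_ c hc
    intro m m' hm hm' hmm
    refine loc_dep hln hodd hW (fun m => s (charVec (pmM m)) j) ?_ m' hm' _ m hm le_rfl hmm
    intro π hπ hπW m hm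
    have := hWH π hπ hπW _ (hmem m hm)
    rw [edgeAction_pmM] at this
    exact this
  -- affine combination over the sigma type
  set T := (Finset.range (k+1)).sigma (fun i => PMi n l (2*i+1)) with hT
  set w : (Σ _ : ℕ, Perm (Fin n)) → ℝ := fun q => c q.1 / ((PMi n l (2*q.1+1)).card : ℝ) with hw
  have hTPM : ∀ q ∈ T, IsPM n l q.2 := by
    intro q hq
    rw [hT, Finset.mem_sigma] at hq
    exact (mem_PMi.1 hq.2).1
  have hsumc : ∀ F : ℕ → ℝ, ∑ q ∈ T, w q * F q.1 = ∑ i ∈ Finset.range (k+1), c i * F i := by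
    intro F
    rw [hT, Finset.sum_sigma]
    refine Finset.sum_congr rfl fun i hi => ?_
    simp only [hw]
    rw [Finset.sum_const, nsmul_eq_mul]
    have := hne i hi
    field_simp
  have hw1 : ∑ q ∈ T, w q = 1 := by
    have h1 := hsumc (fun _ => 1)
    have h2 := hc 1 (by simp)
    simp only [eval_one] at h2
    rw [h2] at h1
    simpa using h1
  have hw2 : ∑ q ∈ T, w q * ((2 * q.1 + 1 : ℕ) : ℝ) = 0 := by
    rw [hsumc (fun i => ((2 * i + 1 : ℕ) : ℝ))]
    have h2 := hc X (by simp; omega)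
    simpa only [eval_X] using h2
  set y : Fin d → ℝ := ∑ q ∈ T, w q • s (charVec (pmM q.2)) with hy
  have hyQ : y ∈ Q := by
    rw [hQ]
    refine ⟨?_, ?_⟩
    · refine affsub_sum V T w hw1 _ ?_
      intro q hq
      have := (hs1 _ (hmem _ (hTPM q hq))).1
      rw [hQ] at this
      exact this.1
    · intro j
      have := hnn j
      rw [hy, Finset.sum_apply, hT, Finset.sum_sigma]
      exact this
  have hpy : p y = ∑ q ∈ T, w q • charVec (pmM q.2) := by
    rw [hy, affine_sum p T w hw1]
    refine Finset.sum_congr rfl fun q hq => ?_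
    rw [(hs1 _ (hmem _ (hTPM q hq))).2]
  have hphi := phi_ge hln hodd (x := p y) (by rw [← hp]; exact ⟨y, hyQ, rfl⟩)
  rw [hpy, map_sum] at hphi
  have : ∑ q ∈ T, phi n l (w q • charVec (pmM q.2)) = ∑ q ∈ T, w q * ((2 * q.1 + 1 : ℕ) : ℝ) := by
    refine Finset.sum_congr rfl fun q hq => ?_
    rw [map_smul, phi_pmM (hTPM q hq), smul_eq_mul]
    rw [hT, Finset.mem_sigma] at hq
    rw [(mem_PMi.1 hq.2).2]
  rw [this, hw2] at hphi
  linarith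

lemma case_zero (n l : ℕ) (hn : 3 ≤ n) (hodd : l = 1)
    (d : ℕ) (hd : d ≤ 1) (Q : Set (Fin d → ℝ))
    (p : (Fin d → ℝ) →ᵃ[ℝ] (Edge n → ℝ)) (hp : p '' Q = matchingPolytope n l)
    (hsym : ∀ π : Equiv.Perm (Fin n), ∃ σ : Equiv.Perm (Fin d),
        coordAction σ '' Q = Q ∧ ∀ y ∈ Q, p (coordAction σ y) = edgeAction π (p y)) : False := by
  classical
  let a : Fin n := ⟨0, by omega⟩
  let b : Fin n := ⟨1, by omega⟩
  let c : Fin n := ⟨2, by omega⟩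
  have hab : a ≠ b := by simp [a, b]
  have hac : a ≠ c := by simp [a, c]
  have hbc : b ≠ c := by simp [b, c]
  let e : Edge n := ⟨s(a, b), by simpa using hab⟩
  have hx : charVec {e} ∈ matchingPolytope n l := by
    refine subset_convexHull ℝ _ ⟨{e}, ?_, by simp [hodd], rfl⟩
    intro e1 h1 e2 h2 hne
    rw [Finset.mem_singleton] at h1 h2
    exact absurd (h1.trans h2.symm) hne
  rw [← hp] at hx
  obtain ⟨y, hy, hyx⟩ := hx
  obtain ⟨σ, _, h2⟩ := hsym (swap b c)
  have hσ : σ = 1 := by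
    have : Subsingleton (Fin d) := by
      rw [Fin.subsingleton_iff_le_one]; exact hd
    exact Subsingleton.elim _ _
  have h3 := h2 y hy
  rw [hσ, coordAction_one, hyx] at h3
  have h4 := congrFun h3 e
  have h5 : edgeMap (swap b c)⁻¹ e ≠ e := by
    intro h
    have := congrArg Subtype.val h
    simp only [edgeMap, e, swap_inv, Sym2.map_mk, swap_apply_left] at this
    rw [swap_apply_of_ne_of_ne hab hac] at this
    rcases Sym2.eq_iff.1 this with h | h
    · exact hbc h.2.symm
    · exact hab h.1
  rw [swap_inv] at h5
  simp [charVec, edgeAction] at h4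
  exact h5 h4

end Main

section CaseOne
open Equiv

open Classical in
noncomputable def evS {n : ℕ} (z : Sym2 (Fin n)) : Edge n → ℝ := fun e => if e.1 = z then 1 else 0

lemma three_mem {n : ℕ} (a b c d x y : Fin n) (h : [a, b, c, d, x, y].Nodup) :
    (evS s(a, b) + evS s(c, d) + evS s(x, y) : Edge n → ℝ) ∈ matchingPolytope n 3 := by
  classical
  simp only [List.nodup_cons, List.mem_cons, List.not_mem_nil, not_or, or_false, List.nodup_nil, and_true, not_false_eq_true] at h
  obtain ⟨⟨h1, h2, h3, h4, h5⟩, ⟨h6, h7, h8, h9⟩, ⟨h10, h11, h12⟩, ⟨h13, h14⟩, h15⟩ := h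
  let e1 : Edge n := ⟨s(a, b), by simpa using h1⟩
  let e2 : Edge n := ⟨s(c, d), by simpa using h10⟩
  let e3 : Edge n := ⟨s(x, y), by simpa using h15⟩
  have n12 : e1 ≠ e2 := by
    intro h; have := congrArg Subtype.val h
    rcases Sym2.eq_iff.1 this with h | h
    · exact h2 h.1
    · exact h3 h.1
  have n13 : e1 ≠ e3 := by
    intro h; have := congrArg Subtype.val h
    rcases Sym2.eq_iff.1 this with h | h
    · exact h4 h.1
    · exact h5 h.1
  have n23 : e2 ≠ e3 := by
    intro h; have := congrArg Subtype.val h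
    rcases Sym2.eq_iff.1 this with h | h
    · exact h11 h.1
    · exact h12 h.1
  refine subset_convexHull ℝ _ ⟨{e1, e2, e3}, ?_, ?_, ?_⟩
  · intro f hf g hg hne v hv
    simp only [Finset.mem_insert, Finset.mem_singleton] at hf hg
    have m1 : v ∈ e1.1 ↔ v = a ∨ v = b := Sym2.mem_iff
    have m2 : v ∈ e2.1 ↔ v = c ∨ v = d := Sym2.mem_iff
    have m3 : v ∈ e3.1 ↔ v = x ∨ v = y := Sym2.mem_iff
    rcases hf with rfl | rfl | rfl <;> rcases hg with rfl | rfl | rfl <;>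
      first
      | exact hne rfl
      | (simp only [m1, m2, m3] at hv
         obtain ⟨hv1, hv2⟩ := hv
         rcases hv1 with rfl | rfl <;> rcases hv2 with rfl | rfl <;> contradiction)
  · exact Finset.card_eq_three.2 ⟨e1, e2, e3, n12, n13, n23, rfl⟩
  · funext e
    have q1 : e.1 = s(a, b) ↔ e = e1 := ⟨fun h => Subtype.ext h, fun h => by rw [h]⟩
    have q2 : e.1 = s(c, d) ↔ e = e2 := ⟨fun h => Subtype.ext h, fun h => by rw [h]⟩
    have q3 : e.1 = s(x, y) ↔ e = e3 := ⟨fun h => Subtype.ext h, fun h => by rw [h]⟩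
    simp only [evS, charVec, Pi.add_apply, q1, q2, q3, Finset.mem_insert, Finset.mem_singleton]
    by_cases r1 : e = e1
    · subst r1; simp [n12, n13]
    · by_cases r2 : e = e2
      · subst r2; simp [n23, r1]
      · simp [r1, r2]

lemma range_mem {n d : ℕ} (hn : 6 ≤ n) (Q : Set (Fin d → ℝ))
    (p : (Fin d → ℝ) →ᵃ[ℝ] (Edge n → ℝ)) (hp : p '' Q = matchingPolytope n 3)
    (a b c e : Fin n) (h : [a, b, c, e].Nodup) :
    (evS s(a, b) + evS s(c, e) - evS s(a, c) - evS s(b, e) : Edge n → ℝ) ∈ LinearMap.range p.linear := by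
  classical
  have h1 : ({a, b, c, e} : Finset (Fin n)).card < (Finset.univ : Finset (Fin n)).card := by
    rw [Finset.card_univ, Fintype.card_fin]
    exact lt_of_le_of_lt Finset.card_le_four (by omega)
  obtain ⟨x, _, hx⟩ := Finset.exists_mem_notMem_of_card_lt_card h1
  have h2 : (insert x ({a, b, c, e} : Finset (Fin n))).card < (Finset.univ : Finset (Fin n)).card := by
    rw [Finset.card_univ, Fintype.card_fin]
    have := Finset.card_insert_le x ({a, b, c, e} : Finset (Fin n))
    have := Finset.card_le_four (a := a) (b := b) (c := c) (d := e)
    omega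
  obtain ⟨y, _, hy⟩ := Finset.exists_mem_notMem_of_card_lt_card h2
  simp only [Finset.mem_insert, Finset.mem_singleton, not_or] at hx hy
  simp only [List.nodup_cons, List.mem_cons, List.not_mem_nil, not_or, or_false, List.nodup_nil, and_true, not_false_eq_true] at h
  obtain ⟨⟨h1, h2, h3⟩, ⟨h4, h5⟩, h6⟩ := h
  obtain ⟨x1, x2, x3, x4⟩ := hx
  obtain ⟨y0, y1, y2, y3, y4⟩ := hy
  have t1 := three_mem a b c e x y (by simp [*, Ne.symm])
  have t2 := three_mem a c b e x y (by simp [*, Ne.symm, eq_comm]; grind)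
  rw [← hp] at t1 t2
  obtain ⟨q1, _, hq1⟩ := t1
  obtain ⟨q2, _, hq2⟩ := t2
  refine ⟨q1 - q2, ?_⟩
  have := p.linearMap_vsub q1 q2
  rw [vsub_eq_sub, vsub_eq_sub, hq1, hq2] at this
  rw [this]
  abel

lemma case_one (n : ℕ) (hn : 6 ≤ n) (d : ℕ) (hd : d ≤ n) (Q : Set (Fin d → ℝ))
    (p : (Fin d → ℝ) →ᵃ[ℝ] (Edge n → ℝ)) (hp : p '' Q = matchingPolytope n 3) : False := by
  classical
  let o : Fin n := ⟨0, by omega⟩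
  let i : Fin n := ⟨1, by omega⟩
  let t : Fin n := ⟨2, by omega⟩
  have hoi : o ≠ i := by simp [o, i]
  have hot : o ≠ t := by simp [o, t]
  have hit : i ≠ t := by simp [i, t]
  let Zp : Edge n → Prop := fun e => i ∉ e.1 ∧ e.1 ≠ s(o, t)
  let Z := {e : Edge n // Zp e}
  let R : (Edge n → ℝ) →ₗ[ℝ] (Z → ℝ) := LinearMap.funLeft ℝ ℝ Subtype.val
  let K := LinearMap.range (R ∘ₗ p.linear)
  have hA : ∀ a b c e : Fin n, [a, b, c, e].Nodup →
      R (evS s(a, b)) + R (evS s(c, e)) - R (evS s(a, c)) - R (evS s(b, e)) ∈ K := by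
    intro a b c e h
    obtain ⟨q, hq⟩ := range_mem hn Q p hp a b c e h
    refine ⟨q, ?_⟩
    rw [LinearMap.comp_apply, hq]
    simp only [map_add, map_sub]
  have hRi : ∀ x, R (evS s(i, x)) = 0 := by
    intro x
    funext z
    simp only [R, LinearMap.funLeft_apply, evS, Pi.zero_apply]
    rw [if_neg]
    intro h
    apply z.2.1
    rw [h]; simp
  have hRi' : ∀ x, R (evS s(x, i)) = 0 := by
    intro x; rw [Sym2.eq_swap]; exact hRi x
  have hRo : R (evS s(t, o)) = 0 := by
    funext z
    simp only [R, LinearMap.funLeft_apply, evS, Pi.zero_apply]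
    rw [if_neg]
    intro h
    apply z.2.2
    rw [h]; exact Sym2.eq_swap
  have c1 : ∀ x, x ≠ o → x ≠ i → R (evS s(x, o)) ∈ K := by
    intro x h1 h2
    by_cases h3 : x = t
    · rw [h3, hRo]; exact K.zero_mem
    · have := hA i x t o (by simp [*, Ne.symm, eq_comm])
      rw [hRi, hRo, hRi] at this
      simpa using this
  have c2 : ∀ c x, c ≠ x → c ≠ i → x ≠ i → R (evS s(c, x)) ∈ K := by
    intro c x h1 h2 h3
    by_cases h4 : x = o
    · rw [h4]; exact c1 c (by rw [← h4]; exact h1) h2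
    by_cases h5 : c = o
    · rw [h5, Sym2.eq_swap]; exact c1 x h4 h3
    have := hA c x i o (by simp [*, Ne.symm, eq_comm])
    rw [hRi, hRi'] at this
    have h6 := K.add_mem this (c1 x h4 h3)
    simpa using h6
  have c3 : ∀ z : Z, (Pi.single z (1:ℝ) : Z → ℝ) ∈ K := by
    intro z
    have e1 : (Pi.single z (1:ℝ) : Z → ℝ) = R (evS z.1.1) := by
      funext z'
      simp only [R, LinearMap.funLeft_apply, evS, Pi.single_apply]
      congr 1
      rw [eq_iff_iff]
      exact ⟨fun h => by rw [h], fun h => Subtype.ext (Subtype.ext h)⟩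
    rw [e1]
    obtain ⟨⟨z, hz⟩, h1, h2⟩ := z
    induction z using Sym2.ind with
    | _ a b =>
      simp only [Sym2.mem_iff, not_or] at h1
      exact c2 a b (by simpa using hz) (Ne.symm h1.1) (Ne.symm h1.2)
  have hsurj : Function.Surjective (R ∘ₗ p.linear) := by
    rw [← LinearMap.range_eq_top, eq_top_iff]
    intro y _
    rw [← Finset.univ_sum_single y]
    refine Submodule.sum_mem _ fun z _ => ?_
    have : (Pi.single z (y z) : Z → ℝ) = y z • Pi.single z 1 := by
      rw [← Pi.single_smul]; simp
    rw [this]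
    exact K.smul_mem _ (c3 z)
  have hfr := LinearMap.finrank_le_finrank_of_surjective hsurj
  rw [Module.finrank_fintype_fun_eq_card, Module.finrank_fintype_fun_eq_card, Fintype.card_fin] at hfr
  have hcE : Fintype.card (Edge n) = n.choose 2 := by
    have := Sym2.card_subtype_not_diag (α := Fin n)
    rw [Fintype.card_fin] at this
    convert this
  have hcZ : Fintype.card (Edge n) ≤ Fintype.card Z + n := by
    have h1 : Fintype.card (Edge n) = Fintype.card Z + Fintype.card {e : Edge n // ¬ Zp e} := by
      rw [← Fintype.card_congr (Equiv.sumCompl Zp), Fintype.card_sum]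
    rw [h1]
    gcongr
    have h2 : ∀ e : {e : Edge n // ¬ Zp e}, ∃ v : Fin n, e.1.1 = if v = i then s(o, t) else s(i, v) := by
      rintro ⟨⟨e, he⟩, hZ⟩
      by_cases hie : i ∈ e
      · obtain ⟨v, rfl⟩ := hie
        refine ⟨v, ?_⟩
        rw [if_neg]
        intro h
        apply he
        rw [h]; simp
      · refine ⟨i, ?_⟩
        simp only [if_true]
        by_contra h
        exact hZ ⟨hie, h⟩
    choose v hv using h2
    have hinj : Function.Injective v := by
      intro e e' h
      apply Subtype.ext
      apply Subtype.ext
      rw [hv e, hv e', h]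
    simpa using Fintype.card_le_of_injective v hinj
  have h3 : n.choose 2 ≤ 2 * n := by omega
  have h4 := num_succ n 1
  rw [Nat.choose_one_right] at h4
  have h5 : n * (n - 1) ≤ n * 4 := by
    simp only [Nat.reduceAdd] at h4
    omega
  have := Nat.le_of_mul_le_mul_left h5 (by omega)
  omega

end CaseOne

/-- Theorem 3.1.  For `n ≥ 3` and odd `ℓ = 2k+1` with `ℓ ≤ n/2`,
there is no coordinate-symmetric subspace extension of `P_match(ℓ,n)` with at most
`binomial(n, k)` variables:  there is no `d ≤ C(n,k)`, no `Q = V ∩ ℝ₊^d` and no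
affine `p` with `p(Q) = P_match(ℓ,n)` such that every node permutation `π ∈ S_n`
admits a coordinate permutation `κ_π` of `ℝ^d` with `κ_π.Q = Q` and
`p(κ_π y) = π.p(y)` on `Q`. -/
theorem statement4 (n ℓ k : ℕ) (hn : 3 ≤ n) (hodd : ℓ = 2 * k + 1) (hln : 2 * ℓ ≤ n) :
    ¬ ∃ (d : ℕ) (_ : d ≤ Nat.choose n k)
        (V : AffineSubspace ℝ (Fin d → ℝ)) (Q : Set (Fin d → ℝ))
        (_ : Q = {y : Fin d → ℝ | y ∈ V ∧ ∀ j, 0 ≤ y j})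
        (p : (Fin d → ℝ) →ᵃ[ℝ] (Edge n → ℝ))
        (_ : p '' Q = matchingPolytope n ℓ),
      ∀ π : Equiv.Perm (Fin n), ∃ σ : Equiv.Perm (Fin d),
        coordAction σ '' Q = Q ∧
        ∀ y ∈ Q, p (coordAction σ y) = edgeAction π (p y) := by
  rintro ⟨d, hd, V, Q, hQ, p, hp, hsym⟩
  rcases Nat.lt_or_ge k 2 with hk | hk
  · interval_cases k
    · exact case_zero n ℓ hn (by omega) d (by simpa using hd) Q p hp hsym
    · have h3 : ℓ = 3 := by omega
      subst h3
      exact case_one n (by omega) d (by simpa using hd) Q p hp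
  · exact main_case n ℓ k hk hodd hln d hd V Q hQ p hp hsym

end
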